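/- arXiv:1201.3302 — 8 statements merged into one kernel-verified Lean document; each statement's English description precedes it below -/
import Mathlib

section
/- Let β* ∈ E and let Q ∈ E be a generalized exact primal-dual certificate, i.e., −(gL̄(Q) − gL̄(β̄) + gL(β*)) ∈ G. Assume in addition that D_L(β̄, β) ≥ D_L̄(β, β̄) for all β ∈ Ω. Then D_L(β̂, β*) + (R(β̂) − R_G(β̂)) ≤ D_L(β̄, β*) + D_L̄(β̄, Q). -/
open RealInnerProductSpace

/-- An affine function that is nonnegative on `(0, 1]` is nonnegative at `0`. -/
lemma nonneg_of_affine_nonneg {a b : ℝ} (h : ∀ t : ℝ, 0 < t → t ≤ 1 → 0 ≤ a + t * b) :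
    0 ≤ a := by
  by_contra! ha
  have hb : 0 < |b| - a := by linarith [abs_nonneg b]
  set t := -a / (2 * (|b| - a)) with ht
  have hta : t * (2 * (|b| - a)) = -a := by rw [ht]; field_simp
  have ht0 : 0 < t := div_pos (by linarith) (by linarith)
  have ht1 : t ≤ 1 := by
    rw [ht, div_le_one (by linarith)]
    linarith [abs_nonneg b]
  nlinarith [h t ht0 ht1, mul_le_mul_of_nonneg_left (le_abs_self b) ht0.le,
    mul_neg_of_pos_of_neg ht0 ha]

/-- If `x` minimizes `L + R` over `Ω` and the Bregman divergence `D_L(y, ·)` dominates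
`D_M(·, y)` on `Ω`, then the suboptimality of `y` is at least `D_M(x, y)`. Only the subgradient
inequality for `gL` and `gM` is used, so `L` and `M` need not be differentiable. -/
lemma bregman_le_suboptimality
    {E : Type*} [NormedAddCommGroup E] [InnerProductSpace ℝ E]
    {L M R : E → ℝ} {gL gM : E → E}
    (hL : ∀ x y : E, L x + ⟪gL x, y - x⟫ ≤ L y)
    (hM : ∀ x y : E, M x + ⟪gM x, y - x⟫ ≤ M y)
    (hR : ConvexOn ℝ Set.univ R)
    {Ω : Set E} (hΩ : Convex ℝ Ω) {x y : E} (hx : x ∈ Ω) (hy : y ∈ Ω)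
    (hmin : ∀ z ∈ Ω, L x + R x ≤ L z + R z)
    (hD : ∀ z ∈ Ω, M z - M y - ⟪gM y, z - y⟫ ≤ L y - L z - ⟪gL z, y - z⟫) :
    M x - M y - ⟪gM y, x - y⟫ ≤ L y + R y - (L x + R x) := by
  rw [← sub_nonneg]
  refine nonneg_of_affine_nonneg
    (b := R x - R y - ⟪gL x, y - x⟫ - ⟪gM x, y - x⟫ - ⟪gM y, x - y⟫) fun t ht0 ht1 => ?_
  obtain ⟨z, hz⟩ : ∃ z, z = (1 - t) • x + t • y := ⟨_, rfl⟩
  have hzΩ : z ∈ Ω := hz ▸ hΩ hx hy (by linarith) ht0.le (by ring)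
  have hRz : R z ≤ (1 - t) * R x + t * R y := by
    simpa [hz] using hR.2 (Set.mem_univ x) (Set.mem_univ y)
      (by linarith : 0 ≤ 1 - t) ht0.le (by ring)
  have hzx : z - x = t • (y - x) := by rw [hz]; module
  have hxz : x - z = (-t) • (y - x) := by rw [hz]; module
  have hyz : y - z = (1 - t) • (y - x) := by rw [hz]; module
  have hzy : z - y = (1 - t) • (x - y) := by rw [hz]; module
  have hLz := hL z x
  have hLx := hL x z
  have hMx := hM x z
  have hDz := hD z hzΩ
  rw [hxz, inner_smul_right] at hLz
  rw [hzx, inner_smul_right] at hLx hMx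
  rw [hyz, hzy, inner_smul_right, inner_smul_right] at hDz
  have hslope : R x - R y ≤ ⟪gL z, y - x⟫ :=
    le_of_mul_le_mul_left (by linarith [hmin z hzΩ]) ht0
  have := mul_le_mul_of_nonneg_left hslope (by linarith : 0 ≤ 1 - t)
  linarith

/-- Corollary `cor:dual_certificate-oracle`: if `Q` is a generalized exact
primal-dual certificate, i.e. `−(gL̄(Q) − gL̄(β̄) + gL(β*)) ∈ G`, and
`D_L(β̄, β) ≥ D_L̄(β, β̄)` for all `β ∈ Ω`, then
`D_L(β̂, β*) + (R(β̂) − R_G(β̂)) ≤ D_L(β̄, β*) + D_L̄(β̄, Q)`. -/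
theorem stmt3
    {E : Type*} [NormedAddCommGroup E] [InnerProductSpace ℝ E] [FiniteDimensional ℝ E]
    (L Lbar R : E → ℝ) (gL gLbar : E → E)
    (hLconv : ConvexOn ℝ Set.univ L)
    (hgrad : ∀ x y : E, L x + ⟪gL x, y - x⟫ ≤ L y)
    (hLbarconv : ConvexOn ℝ Set.univ Lbar)
    (hgradbar : ∀ x y : E, Lbar x + ⟪gLbar x, y - x⟫ ≤ Lbar y)
    (hRconv : ConvexOn ℝ Set.univ R)
    (Ω : Set E) (hΩ : Convex ℝ Ω)
    (βhat : E) (hβhatΩ : βhat ∈ Ω)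
    (hmin : ∀ β ∈ Ω, L βhat + R βhat ≤ L β + R β)
    (βbar : E) (hβbarΩ : βbar ∈ Ω)
    (G : Set E) (hGne : G.Nonempty) (hGcp : IsCompact G) (hGcv : Convex ℝ G)
    (hGsub : ∀ v ∈ G, ∀ y : E, R βbar + ⟪v, y - βbar⟫ ≤ R y)
    (βstar Q : E)
    (hQ : -(gLbar Q - gLbar βbar + gL βstar) ∈ G)
    (hDD : ∀ β ∈ Ω,
      (Lbar β - Lbar βbar - ⟪gLbar βbar, β - βbar⟫)
        ≤ (L βbar - L β - ⟪gL β, βbar - β⟫)) :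
    (L βhat - L βstar - ⟪gL βstar, βhat - βstar⟫)
      + (R βhat - (R βbar + sSup ((fun u => ⟪u, βhat - βbar⟫) '' G)))
      ≤ (L βbar - L βstar - ⟪gL βstar, βbar - βstar⟫)
        + (Lbar βbar - Lbar Q - ⟪gLbar Q, βbar - Q⟫) := by
  have hbase := bregman_le_suboptimality hgrad hgradbar hRconv hΩ hβhatΩ hβbarΩ hmin hDD
  have hsup : ⟪-(gLbar Q - gLbar βbar + gL βstar), βhat - βbar⟫
      ≤ sSup ((fun u => ⟪u, βhat - βbar⟫) '' G) :=
    le_csSup (hGcp.image (by fun_prop)).bddAbove (Set.mem_image_of_mem _ hQ)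
  have hQhat := hgradbar Q βhat
  simp only [inner_neg_left, inner_add_left, inner_sub_left, inner_sub_right] at *
  linarith
end

section
/- Oracle inequality under global restricted strong convexity: let β* ∈ E and define L̄*(β) = L̄(β) − ⟪gL̄(β̄) − gL(β*), β − β̄⟫. Let r > 0 and suppose γ > 0 satisfies: for every β with N(β − β̄) ≤ r, β ≠ β̄, and D_L̄^s(β, β̄) + sup_{u ∈ G} ⟪u + gL(β*), β − β̄⟫ ≤ 0, one has D_L̄^s(β, β̄) ≥ γ·N(β − β̄)². Set Δ_r = γ⁻¹·inf_{u ∈ G} N_D(u + gL(β*)) and assume Δ_r < r. Suppose there exists r̃ > D_L(β̄, β*) + γ·Δ_r² such that for all β ∈ Ω, D_L(β, β*) + (R(β) − R_G(β)) ≤ r̃ implies D_L(β̄, β) ≥ D_L̄(β, β̄). Assume also that L̄* + R_G attains a minimum over E. Then D_L(β̂, β*) + (R(β̂) − R_G(β̂)) ≤ D_L(β̄, β*) + γ·Δ_r². -/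
open RealInnerProductSpace

section SupportFunction

variable {E : Type*} [NormedAddCommGroup E] [InnerProductSpace ℝ E]

lemma IsCompact.bddAbove_image_inner {G : Set E} (hG : IsCompact G) (a d : E) :
    BddAbove ((fun u => ⟪u + a, d⟫) '' G) :=
  (hG.image (by fun_prop)).bddAbove

lemma IsCompact.inner_le_support {G : Set E} (hG : IsCompact G) {u : E} (hu : u ∈ G) (d : E) :
    ⟪u, d⟫ ≤ sSup ((fun u => ⟪u, d⟫) '' G) :=
  le_csSup (hG.image (by fun_prop)).bddAbove ⟨u, hu, rfl⟩

lemma support_smul {G : Set E} {t : ℝ} (ht : 0 ≤ t) (d : E) :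
    sSup ((fun u => ⟪u, t • d⟫) '' G) = t * sSup ((fun u => ⟪u, d⟫) '' G) := by
  rw [← smul_eq_mul, ← Real.sSup_smul_of_nonneg ht, ← Set.image_smul, Set.image_image]
  simp only [inner_smul_right, smul_eq_mul]

lemma support_add_const {G : Set E} (hne : G.Nonempty) (hG : IsCompact G) (a d : E) :
    sSup ((fun u => ⟪u + a, d⟫) '' G) = ⟪a, d⟫ + sSup ((fun u => ⟪u, d⟫) '' G) := by
  apply le_antisymm
  · apply csSup_le (hne.image _)
    rintro _ ⟨u, hu, rfl⟩
    have := hG.inner_le_support hu d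
    simp only [inner_add_left]
    linarith
  · have : sSup ((fun u => ⟪u, d⟫) '' G) ≤ sSup ((fun u => ⟪u + a, d⟫) '' G) - ⟪a, d⟫ := by
      apply csSup_le (hne.image _)
      rintro _ ⟨u, hu, rfl⟩
      have := le_csSup (hG.bddAbove_image_inner a d) ⟨u, hu, rfl⟩
      simp only [inner_add_left] at this ⊢
      linarith
    linarith

end SupportFunction

section DualNorm

variable {E : Type*} [NormedAddCommGroup E] [InnerProductSpace ℝ E] [FiniteDimensional ℝ E]

/-- Every norm on a finite-dimensional space dominates a positive multiple of the given one. -/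
lemma exists_pos_mul_norm_le {N : E → ℝ}
    (hNnonneg : ∀ x, 0 ≤ N x) (hNzero : ∀ x, N x = 0 ↔ x = 0)
    (hNsmul : ∀ (c : ℝ) (x : E), N (c • x) = |c| * N x)
    (hNadd : ∀ x y : E, N (x + y) ≤ N x + N y) :
    ∃ m : ℝ, 0 < m ∧ ∀ x, m * ‖x‖ ≤ N x := by
  have hconv : ConvexOn ℝ Set.univ N := by
    refine ⟨convex_univ, fun x _ y _ a b ha hb _ => (hNadd _ _).trans ?_⟩
    rw [hNsmul, hNsmul, abs_of_nonneg ha, abs_of_nonneg hb, smul_eq_mul, smul_eq_mul]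
  have hcont : Continuous N := continuousOn_univ.mp (hconv.continuousOn isOpen_univ)
  rcases (Metric.sphere (0 : E) 1).eq_empty_or_nonempty with he | hne
  · refine ⟨1, one_pos, fun x => ?_⟩
    have hx : x = 0 := by
      by_contra hx
      have : ‖x‖⁻¹ • x ∈ Metric.sphere (0 : E) 1 := by
        simp [norm_smul, norm_ne_zero_iff.mpr hx]
      simp [he] at this
    simpa [hx] using hNnonneg 0
  · obtain ⟨z, hz, hzmin⟩ := (isCompact_sphere (0 : E) 1).exists_isMinOn hne hcont.continuousOn
    have hz0 : z ≠ 0 := by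
      rintro rfl
      simp at hz
    refine ⟨N z, lt_of_le_of_ne (hNnonneg z) fun h => hz0 ((hNzero z).1 h.symm), fun x => ?_⟩
    rcases eq_or_ne x 0 with rfl | hx
    · simpa using hNnonneg 0
    have hpos : 0 < ‖x‖ := norm_pos_iff.mpr hx
    have hmem : ‖x‖⁻¹ • x ∈ Metric.sphere (0 : E) 1 := by
      simp [norm_smul, hpos.ne']
    have h : N z ≤ N (‖x‖⁻¹ • x) := hzmin hmem
    rw [hNsmul, abs_of_pos (inv_pos.mpr hpos), inv_mul_eq_div, le_div_iff₀ hpos] at h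
    exact h

lemma neg_inner_le_dualNorm_mul {N : E → ℝ}
    (hNnonneg : ∀ x, 0 ≤ N x) (hNzero : ∀ x, N x = 0 ↔ x = 0)
    (hNsmul : ∀ (c : ℝ) (x : E), N (c • x) = |c| * N x)
    (hNadd : ∀ x y : E, N (x + y) ≤ N x + N y) (w x : E) :
    -⟪w, x⟫ ≤ sSup ((fun β => ⟪w, β⟫) '' {β : E | N β ≤ 1}) * N x := by
  obtain ⟨m, hm, hmN⟩ := exists_pos_mul_norm_le hNnonneg hNzero hNsmul hNadd
  have hbdd : BddAbove ((fun β => ⟪w, β⟫) '' {β : E | N β ≤ 1}) := by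
    refine ⟨‖w‖ * m⁻¹, ?_⟩
    rintro _ ⟨β, hβ, rfl⟩
    refine (real_inner_le_norm w β).trans (mul_le_mul_of_nonneg_left ?_ (norm_nonneg w))
    rw [← one_div, le_div_iff₀ hm, mul_comm]
    exact (hmN β).trans hβ
  rcases eq_or_ne x 0 with rfl | hx
  · simp [(hNzero 0).2 rfl]
  have hpos : 0 < N x := lt_of_le_of_ne (hNnonneg x) fun h => hx ((hNzero x).1 h.symm)
  have h : ⟪w, (-(N x)⁻¹) • x⟫ ≤ sSup ((fun β => ⟪w, β⟫) '' {β : E | N β ≤ 1}) := by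
    refine le_csSup hbdd ⟨_, ?_, rfl⟩
    rw [Set.mem_ofPred_eq, hNsmul, abs_neg, abs_of_pos (inv_pos.mpr hpos), inv_mul_cancel₀ hpos.ne']
  rw [inner_smul_right, neg_mul, inv_mul_eq_div, ← neg_div, div_le_iff₀ hpos] at h
  exact h

end DualNorm

/-- If `x` minimizes `L + R` against the point `y + t • (x - y)` of the segment from `y` to `x`,
then the linearization of `L` at that point, added to `R`, does not exceed its value at `y`. -/
lemma add_mul_inner_le_of_minimizer {E : Type*} [NormedAddCommGroup E] [InnerProductSpace ℝ E]
    {L R : E → ℝ} {gL : E → E} (hgrad : ∀ x y : E, L x + ⟪gL x, y - x⟫ ≤ L y)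
    (hR : ConvexOn ℝ Set.univ R) {x y : E} {t : ℝ} (ht : 0 ≤ t) (ht1 : t < 1)
    (hmin : L x + R x ≤ L (y + t • (x - y)) + R (y + t • (x - y))) :
    R (y + t • (x - y)) + t * ⟪gL (y + t • (x - y)), x - y⟫ ≤ R y := by
  have hconv := hR.2 (Set.mem_univ y) (Set.mem_univ x) (by linarith : 0 ≤ 1 - t) ht (by ring)
  rw [show (1 - t) • y + t • x = y + t • (x - y) by module, smul_eq_mul, smul_eq_mul] at hconv
  have hg := hgrad (y + t • (x - y)) x
  rw [show x - (y + t • (x - y)) = (1 - t) • (x - y) by module, inner_smul_right] at hg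
  generalize ⟪gL (y + t • (x - y)), x - y⟫ = c at *
  generalize R (y + t • (x - y)) = ρ at *
  have hb : R x + (1 - t) * c ≤ ρ := by linarith
  have hc := mul_le_mul_of_nonneg_left hb ht
  have : (1 - t) * (ρ + t * c) ≤ (1 - t) * R y := by linarith
  exact le_of_mul_le_mul_left this (by linarith)

/-- Corollary `cor:recovery-global-dc-oracle`, oracle inequality under global
restricted strong convexity: with `L̄*(β) = L̄(β) − ⟪gL̄(β̄) − gL(β*), β − β̄⟫`, under the
RSC property for `L̄` with constant `γ > 0` at radius `r`, if
`Δ_r = γ⁻¹·inf_{u ∈ G} N_D(u + gL(β*)) < r`, there exists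
`r̃ > D_L(β̄, β*) + γ·Δ_r²` such that `D_L(β, β*) + (R(β) − R_G(β)) ≤ r̃` implies
`D_L(β̄, β) ≥ D_L̄(β, β̄)` for `β ∈ Ω`, and `L̄* + R_G` attains a minimum over `E`, then
`D_L(β̂, β*) + (R(β̂) − R_G(β̂)) ≤ D_L(β̄, β*) + γ·Δ_r²`. -/
theorem stmt7
    {E : Type*} [NormedAddCommGroup E] [InnerProductSpace ℝ E] [FiniteDimensional ℝ E]
    (L Lbar R : E → ℝ) (gL gLbar : E → E)
    (hLconv : ConvexOn ℝ Set.univ L)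
    (hgrad : ∀ x y : E, L x + ⟪gL x, y - x⟫ ≤ L y)
    (hLbarconv : ConvexOn ℝ Set.univ Lbar)
    (hgradbar : ∀ x y : E, Lbar x + ⟪gLbar x, y - x⟫ ≤ Lbar y)
    (hRconv : ConvexOn ℝ Set.univ R)
    (Ω : Set E) (hΩ : Convex ℝ Ω)
    (βhat : E) (hβhatΩ : βhat ∈ Ω)
    (hmin : ∀ β ∈ Ω, L βhat + R βhat ≤ L β + R β)
    (βbar : E) (hβbarΩ : βbar ∈ Ω)
    (G : Set E) (hGne : G.Nonempty) (hGcp : IsCompact G) (hGcv : Convex ℝ G)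
    (hGsub : ∀ v ∈ G, ∀ y : E, R βbar + ⟪v, y - βbar⟫ ≤ R y)
    (N : E → ℝ)
    (hNnonneg : ∀ x, 0 ≤ N x) (hNzero : ∀ x, N x = 0 ↔ x = 0)
    (hNsmul : ∀ (c : ℝ) (x : E), N (c • x) = |c| * N x)
    (hNadd : ∀ x y : E, N (x + y) ≤ N x + N y)
    (βstar : E)
    (r γ : ℝ) (hr : 0 < r) (hγ : 0 < γ)
    (hRSC : ∀ β : E, N (β - βbar) ≤ r → β ≠ βbar →
      ⟪gLbar β - gLbar βbar, β - βbar⟫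
          + sSup ((fun u => ⟪u + gL βstar, β - βbar⟫) '' G) ≤ 0 →
      γ * N (β - βbar) ^ 2 ≤ ⟪gLbar β - gLbar βbar, β - βbar⟫)
    (Δr : ℝ)
    (hΔr : Δr = γ⁻¹ *
      sInf ((fun u => sSup ((fun β => ⟪u + gL βstar, β⟫) '' {β : E | N β ≤ 1})) '' G))
    (hΔlt : Δr < r)
    (hrtilde : ∃ rt : ℝ,
      (L βbar - L βstar - ⟪gL βstar, βbar - βstar⟫) + γ * Δr ^ 2 < rt ∧
      ∀ β ∈ Ω,
        (L β - L βstar - ⟪gL βstar, β - βstar⟫)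
            + (R β - (R βbar + sSup ((fun u => ⟪u, β - βbar⟫) '' G))) ≤ rt →
        (Lbar β - Lbar βbar - ⟪gLbar βbar, β - βbar⟫)
          ≤ (L βbar - L β - ⟪gL β, βbar - β⟫))
    (hattain : ∃ Q : E, ∀ β : E,
      (Lbar Q - ⟪gLbar βbar - gL βstar, Q - βbar⟫)
          + (R βbar + sSup ((fun u => ⟪u, Q - βbar⟫) '' G))
        ≤ (Lbar β - ⟪gLbar βbar - gL βstar, β - βbar⟫)
          + (R βbar + sSup ((fun u => ⟪u, β - βbar⟫) '' G))) :
    (L βhat - L βstar - ⟪gL βstar, βhat - βstar⟫)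
      + (R βhat - (R βbar + sSup ((fun u => ⟪u, βhat - βbar⟫) '' G)))
      ≤ (L βbar - L βstar - ⟪gL βstar, βbar - βstar⟫) + γ * Δr ^ 2 := by
  set h : E → ℝ := fun d => sSup ((fun u => ⟪u, d⟫) '' G)
  have hsup (d : E) : sSup ((fun u => ⟪u, d⟫) '' G) = h d := rfl
  have hsmul (t : ℝ) (ht : 0 ≤ t) (d : E) : h (t • d) = t * h d := support_smul ht d
  simp only [support_add_const hGne hGcp, hsup] at hRSC hrtilde hattain ⊢
  have hdual (d : E) : -(⟪gL βstar, d⟫ + h d) ≤ γ * Δr * N d := by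
    rw [hΔr, mul_inv_cancel_left₀ hγ.ne']
    have hu (u : E) (hu : u ∈ G) : -(⟪gL βstar, d⟫ + h d) ≤
        sSup ((fun β => ⟪u + gL βstar, β⟫) '' {β : E | N β ≤ 1}) * N d := by
      refine le_trans ?_
        (neg_inner_le_dualNorm_mul hNnonneg hNzero hNsmul hNadd (u + gL βstar) d)
      have : ⟪u, d⟫ ≤ h d := hGcp.inner_le_support hu d
      rw [inner_add_left]
      linarith
    rcases (hNnonneg d).eq_or_lt with h0 | hpos
    · obtain ⟨u, huG⟩ := hGne
      simpa [← h0] using hu u huG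
    · rw [← div_le_iff₀ hpos]
      refine le_csInf (hGne.image _) ?_
      rintro _ ⟨u, huG, rfl⟩
      rw [div_le_iff₀ hpos]
      exact hu u huG
  obtain ⟨Q, hQ⟩ := hattain
  set d := Q - βbar with hd
  have hNd : N d ≤ max Δr 0 := by
    by_contra! hlt
    obtain ⟨s, hs1, hs2⟩ := exists_between (lt_min hlt (max_lt hΔlt hr))
    have hΔs : Δr < s := (le_max_left _ _).trans_lt hs1
    have hs0 : 0 < s := (le_max_right _ _).trans_lt hs1
    have hsN : s < N d := hs2.trans_le (min_le_left _ _)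
    have hsr : s < r := hs2.trans_le (min_le_right _ _)
    have hNpos : 0 < N d := hs0.trans hsN
    obtain ⟨t, ht⟩ : ∃ t, t = s / N d := ⟨_, rfl⟩
    have ht0 : 0 < t := ht ▸ div_pos hs0 hNpos
    have ht1 : t < 1 := by rw [ht, div_lt_one hNpos]; exact hsN
    have htN : N (t • d) = s := by
      rw [hNsmul, abs_of_pos ht0, ht, div_mul_cancel₀ _ hNpos.ne']
    have hsub : βbar + t • d - βbar = t • d := by abel
    have hmono := hQ (βbar + t • d)
    have hg := hgradbar (βbar + t • d) Q
    rw [show Q - (βbar + t • d) = (1 - t) • d by rw [hd]; module, inner_smul_right] at hg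
    rw [hsub, hsmul t ht0.le, inner_smul_right, inner_sub_left] at hmono
    have hkey : (1 - t) * (⟪gLbar (βbar + t • d), d⟫ - ⟪gLbar βbar, d⟫
        + (⟪gL βstar, d⟫ + h d)) ≤ 0 := by linarith
    have hkey : ⟪gLbar (βbar + t • d), d⟫ - ⟪gLbar βbar, d⟫ + (⟪gL βstar, d⟫ + h d) ≤ 0 :=
      nonpos_of_mul_nonpos_right hkey (by linarith)
    have hrsc := hRSC (βbar + t • d) (by rw [hsub, htN]; exact hsr.le)
      (by
        intro heq
        rw [heq, sub_self] at hsub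
        rw [← hsub, (hNzero 0).2 rfl] at htN
        exact hs0.ne htN)
    rw [hsub, htN, hsmul t ht0.le, inner_smul_right, inner_smul_right, inner_sub_left] at hrsc
    have hmul := mul_nonpos_of_nonneg_of_nonpos ht0.le hkey
    have hrsc := hrsc (by linarith)
    have hdt := hdual (t • d)
    rw [htN, hsmul t ht0.le, inner_smul_right] at hdt
    have : γ * s * (s - Δr) ≤ 0 := by linarith
    exact this.not_gt (mul_pos (mul_pos hγ hs0) (by linarith))
  have hQval : -(γ * Δr ^ 2) ≤ ⟪gL βstar, d⟫ + h d := by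
    have h1 := hdual d
    have h2 : Δr * N d ≤ Δr ^ 2 := by
      rcases le_total 0 Δr with h0 | h0
      · rw [max_eq_left h0] at hNd
        nlinarith
      · nlinarith [mul_nonneg_of_nonpos_of_nonpos h0 h0, mul_nonneg (neg_nonneg.2 h0) (hNnonneg d)]
    nlinarith [mul_le_mul_of_nonneg_left h2 hγ.le]
  have hlower (β : E) : -(γ * Δr ^ 2) ≤ Lbar β - Lbar βbar - ⟪gLbar βbar, β - βbar⟫
      + ⟪gL βstar, β - βbar⟫ + h (β - βbar) := by
    have h1 := hQ β
    have h2 := hgradbar βbar Q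
    rw [inner_sub_left, inner_sub_left] at h1
    linarith
  obtain ⟨rt, hrt, hrt'⟩ := hrtilde
  set M := (L βbar - L βstar - ⟪gL βstar, βbar - βstar⟫) + γ * Δr ^ 2 with hM
  by_contra! hlt
  set e := βhat - βbar with he
  let φ : ℝ → ℝ := fun t => (L (βbar + t • e) - L βstar - ⟪gL βstar, βbar + t • e - βstar⟫)
    + (R (βbar + t • e) - (R βbar + t * h e))
  have hLc : Continuous L := continuousOn_univ.mp (hLconv.continuousOn isOpen_univ)
  have hRc : Continuous R := continuousOn_univ.mp (hRconv.continuousOn isOpen_univ)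
  have hφc : Continuous φ := by fun_prop
  have hφ0 : φ 0 ≤ M := by
    simp only [φ, zero_smul, add_zero, zero_mul, sub_self, hM]
    linarith [mul_nonneg hγ.le (sq_nonneg Δr)]
  have hφ1 : M < φ 1 := by
    simpa [φ, he] using hlt
  obtain ⟨c, hc1, hc2⟩ := exists_between (lt_min hrt hφ1)
  have hcφ : c < φ 1 := hc2.trans_le (min_le_right _ _)
  obtain ⟨t, ⟨ht0, ht1⟩, htc⟩ := intermediate_value_Icc zero_le_one hφc.continuousOn
    ⟨hφ0.trans hc1.le, hcφ.le⟩
  have ht1 : t < 1 := lt_of_le_of_ne ht1 (by rintro rfl; exact hcφ.ne' htc)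
  have hmem : βbar + t • e ∈ Ω := hΩ.add_smul_sub_mem hβbarΩ hβhatΩ ⟨ht0, ht1.le⟩
  have hsub : βbar + t • e - βbar = t • e := by abel
  have hopt := add_mul_inner_le_of_minimizer hgrad hRconv ht0 ht1 (hmin _ hmem)
  rw [← he] at hopt
  have hloc := hrt' _ hmem
  rw [hsub, hsmul t ht0] at hloc
  have hloc := hloc (htc.le.trans (hc2.le.trans (min_le_left _ _)))
  rw [show βbar - (βbar + t • e) = -(t • e) by abel, inner_neg_right, inner_smul_right,
    inner_smul_right] at hloc
  have hlow := hlower (βbar + t • e)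
  rw [hsub, hsmul t ht0, inner_smul_right, inner_smul_right] at hlow
  have hval : (L (βbar + t • e) - L βstar - ⟪gL βstar, βbar + t • e - βstar⟫)
    + (R (βbar + t • e) - (R βbar + t * h e)) = c := htc
  rw [show βbar + t • e - βstar = (βbar - βstar) + t • e by abel, inner_add_right,
    inner_smul_right] at hval
  linarith
end

section
/- Gaussian width bound for the restricted cone: one has width(C) = ∫ sup_{z ∈ K} ⟪ε, z⟫ dμ(ε) ≤ ∫ inf{‖γ•(u + v) − ε‖₂ : u ∈ G, γ > 0} dμ(ε); moreover the pointwise inequality sup_{z ∈ K} ⟪ε, z⟫ ≤ inf{‖γ•(u + v) − ε‖₂ : u ∈ G, γ > 0} holds for every ε ∈ ℝ^p. -/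
open MeasureTheory ProbabilityTheory

/-- Cauchy-Schwarz against a unit vector `z` of the polar cone of `w`. -/
theorem sum_mul_le_sqrt_of_sum_mul_nonpos {ι : Type*} [Fintype ι] (ε w z : ι → ℝ) {γ : ℝ}
    (hγ : 0 ≤ γ) (hw : ∑ i, w i * z i ≤ 0) (hz : Real.sqrt (∑ i, z i ^ 2) = 1) :
    ∑ i, ε i * z i ≤ Real.sqrt (∑ i, (γ * w i - ε i) ^ 2) := by
  have hcs := Real.sum_mul_le_sqrt_mul_sqrt Finset.univ (fun i => γ * w i - ε i) (fun i => -z i)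
  simp only [neg_sq, hz, mul_one] at hcs
  have hsum : ∑ i, (γ * w i - ε i) * -z i = ∑ i, ε i * z i - γ * ∑ i, w i * z i := by
    rw [Finset.mul_sum, ← Finset.sum_sub_distrib]
    exact Finset.sum_congr rfl fun i _ => by ring
  have hγw : γ * ∑ i, w i * z i ≤ 0 := mul_nonpos_of_nonneg_of_nonpos hγ hw
  linarith

/-- The infimum of the Euclidean distances from `ε` to the positive multiples of the points of
`G + v`, as a distance to a set. -/
theorem sInf_eq_infDist {ι : Type*} [Fintype ι] (G : Set (ι → ℝ)) (v ε : ι → ℝ) :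
    sInf {x : ℝ | ∃ u ∈ G, ∃ γ : ℝ, 0 < γ ∧
        x = Real.sqrt (∑ i, (γ * (u i + v i) - ε i) ^ 2)} =
      Metric.infDist (WithLp.toLp 2 ε)
        {y : EuclideanSpace ℝ ι | ∃ u ∈ G, ∃ γ : ℝ, 0 < γ ∧
          y = WithLp.toLp 2 fun i => γ * (u i + v i)} := by
  rw [Metric.infDist_eq_iInf, iInf]
  congr 1
  ext x
  constructor
  · rintro ⟨u, hu, γ, hγ, rfl⟩
    refine ⟨⟨_, u, hu, γ, hγ, rfl⟩, ?_⟩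
    simp [dist_comm (WithLp.toLp 2 ε), EuclideanSpace.dist_eq, Real.dist_eq, sq_abs]
  · rintro ⟨⟨_, u, hu, γ, hγ, rfl⟩, rfl⟩
    refine ⟨u, hu, γ, hγ, ?_⟩
    simp [dist_comm (WithLp.toLp 2 ε), EuclideanSpace.dist_eq, Real.dist_eq, sq_abs]

/-- The Euclidean norm is integrable for the standard Gaussian measure. -/
theorem integrable_norm_toLp_pi_gaussianReal {ι : Type*} [Fintype ι] :
    Integrable (fun ε : ι → ℝ => ‖WithLp.toLp 2 ε‖)
      (Measure.pi fun _ : ι => gaussianReal 0 1) := by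
  have hcoord (i : ι) : Integrable (fun ε : ι → ℝ => |ε i|)
      (Measure.pi fun _ : ι => gaussianReal 0 1) := by
    have hid : Integrable (id : ℝ → ℝ) (gaussianReal 0 1) :=
      (memLp_id_gaussianReal 1).integrable le_rfl
    exact ((measurePreserving_eval (fun _ : ι => gaussianReal 0 1) i).integrable_comp_of_integrable
      hid).abs
  refine (integrable_finsetSum Finset.univ fun i _ => hcoord i).mono'
    (by fun_prop) (.of_forall fun ε => ?_)
  rw [norm_norm, EuclideanSpace.norm_eq]
  refine Real.sqrt_le_iff.mpr ⟨Finset.sum_nonneg fun i _ => abs_nonneg _, ?_⟩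
  exact Finset.sum_sq_le_sq_sum_of_nonneg fun i _ => abs_nonneg _

/-- The Euclidean distance to a nonempty set is integrable for the standard Gaussian measure. -/
theorem integrable_infDist_pi_gaussianReal {ι : Type*} [Fintype ι] {S : Set (EuclideanSpace ℝ ι)}
    (hS : S.Nonempty) :
    Integrable (fun ε : ι → ℝ => Metric.infDist (WithLp.toLp 2 ε) S)
      (Measure.pi fun _ : ι => gaussianReal 0 1) := by
  obtain ⟨s, hs⟩ := hS
  refine (integrable_norm_toLp_pi_gaussianReal.add (integrable_const ‖s‖)).mono' ?_
    (.of_forall fun ε => ?_)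
  · exact ((Metric.continuous_infDist_pt S).comp
      (PiLp.continuous_toLp 2 fun _ : ι => ℝ)).aestronglyMeasurable
  · rw [Real.norm_of_nonneg Metric.infDist_nonneg]
    exact (Metric.infDist_le_dist_of_mem hs).trans (dist_le_norm_add_norm _ _)

/-- Proposition `prop:gw`, Gaussian width bound for the restricted cone:
with `C = {β : ⟪u + v, β⟫ ≤ 0 ∀ u ∈ G}` and `K = {z ∈ C : ‖z‖₂ = 1}`,
`width(C) = ∫ sup_{z ∈ K} ⟪ε, z⟫ dμ(ε) ≤ ∫ inf{‖γ•(u+v) − ε‖₂ : u ∈ G, γ > 0} dμ(ε)`,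
and the pointwise inequality holds for every `ε`. -/
theorem stmt9 (p : ℕ)
    (μ : Measure (Fin p → ℝ))
    (hμ : μ = Measure.pi fun _ : Fin p => gaussianReal 0 1)
    (G : Set (Fin p → ℝ)) (hGne : G.Nonempty) (v : Fin p → ℝ)
    (C : Set (Fin p → ℝ))
    (hC : C = {β : Fin p → ℝ | ∀ u ∈ G, (∑ i, (u i + v i) * β i) ≤ 0})
    (K : Set (Fin p → ℝ))
    (hK : K = {z ∈ C | Real.sqrt (∑ i, z i ^ 2) = 1})
    (hKne : K.Nonempty) :
    ((∫ ε, sSup ((fun z => ∑ i, ε i * z i) '' K) ∂μ)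
        ≤ ∫ ε, sInf {x : ℝ | ∃ u ∈ G, ∃ γ : ℝ, 0 < γ ∧
              x = Real.sqrt (∑ i, (γ * (u i + v i) - ε i) ^ 2)} ∂μ)
      ∧ ∀ ε : Fin p → ℝ,
          sSup ((fun z => ∑ i, ε i * z i) '' K)
            ≤ sInf {x : ℝ | ∃ u ∈ G, ∃ γ : ℝ, 0 < γ ∧
                x = Real.sqrt (∑ i, (γ * (u i + v i) - ε i) ^ 2)} := by
  subst hμ
  have hpt : ∀ ε : Fin p → ℝ,
      sSup ((fun z => ∑ i, ε i * z i) '' K)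
        ≤ sInf {x : ℝ | ∃ u ∈ G, ∃ γ : ℝ, 0 < γ ∧
            x = Real.sqrt (∑ i, (γ * (u i + v i) - ε i) ^ 2)} := by
    intro ε
    obtain ⟨u₀, hu₀⟩ := hGne
    refine csSup_le (hKne.image _) ?_
    rintro _ ⟨z, hz, rfl⟩
    refine le_csInf ⟨_, u₀, hu₀, 1, one_pos, rfl⟩ ?_
    rintro _ ⟨u, hu, γ, hγ, rfl⟩
    rw [hK, hC] at hz
    exact sum_mul_le_sqrt_of_sum_mul_nonpos ε (fun i => u i + v i) z hγ.le (hz.1 u hu) hz.2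
  refine ⟨?_, hpt⟩
  by_cases hf : Integrable (fun ε : Fin p → ℝ => sSup ((fun z => ∑ i, ε i * z i) '' K))
      (Measure.pi fun _ : Fin p => gaussianReal 0 1)
  · refine integral_mono hf ?_ hpt
    simp_rw [sInf_eq_infDist]
    refine integrable_infDist_pi_gaussianReal ?_
    obtain ⟨u₀, hu₀⟩ := hGne
    exact ⟨_, u₀, hu₀, 1, one_pos, rfl⟩
  · rw [integral_undef hf]
    refine integral_nonneg fun ε => Real.sInf_nonneg ?_
    rintro _ ⟨u, -, γ, -, rfl⟩
    exact Real.sqrt_nonneg _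
end

section
/- Suppose that for every sign vector w ∈ E₁ one has {Aᵀw : A ∈ 𝒜} = {Aᵀ𝟙 : A ∈ 𝒜}. Then for every β ∈ ℝ^p such that the set {‖Aβ‖₁ : A ∈ 𝒜} is bounded above, the set {⟪Aᵀ𝟙, β⟫ : A ∈ 𝒜} is bounded above as well and sup_{A ∈ 𝒜} ‖Aβ‖₁ = sup_{A ∈ 𝒜} ⟪Aᵀ𝟙, β⟫. -/
/-- Proposition `prop:struct-subdiff` (ii): if `{Aᵀw : A ∈ 𝒜} = {Aᵀ𝟙 : A ∈ 𝒜}`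
for every sign vector `w ∈ E₁`, then for every `β` such that `{‖Aβ‖₁ : A ∈ 𝒜}` is bounded
above, the set `{⟪Aᵀ𝟙, β⟫ : A ∈ 𝒜}` is bounded above as well and
`sup_{A ∈ 𝒜} ‖Aβ‖₁ = sup_{A ∈ 𝒜} ⟪Aᵀ𝟙, β⟫`.  Here `T A w` denotes the adjoint `Aᵀw`,
characterized by `⟪T A w, β⟫ = ⟪w, Aβ⟫` (Euclidean inner products). -/
theorem stmt11 (p q : ℕ)
    (𝒜 : Set ((Fin p → ℝ) →ₗ[ℝ] (Fin q → ℝ))) (h𝒜ne : 𝒜.Nonempty)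
    (T : ((Fin p → ℝ) →ₗ[ℝ] (Fin q → ℝ)) → (Fin q → ℝ) → (Fin p → ℝ))
    (hT : ∀ A : (Fin p → ℝ) →ₗ[ℝ] (Fin q → ℝ), ∀ w : Fin q → ℝ, ∀ β : Fin p → ℝ,
      (∑ i, T A w i * β i) = ∑ j, w j * A β j)
    (hsign : ∀ w : Fin q → ℝ, (∀ j, |w j| = 1) →
      (fun A => T A w) '' 𝒜 = (fun A => T A (fun _ => 1)) '' 𝒜) :
    ∀ β : Fin p → ℝ,
      BddAbove ((fun A => ∑ j, |A β j|) '' 𝒜) →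
      BddAbove ((fun A => ∑ i, T A (fun _ => 1) i * β i) '' 𝒜) ∧
        sSup ((fun A => ∑ j, |A β j|) '' 𝒜)
          = sSup ((fun A => ∑ i, T A (fun _ => 1) i * β i) '' 𝒜) := by
  intro β ⟨M, hM⟩
  have hle (A : (Fin p → ℝ) →ₗ[ℝ] (Fin q → ℝ)) :
      ∑ i, T A (fun _ => 1) i * β i ≤ ∑ j, |A β j| := by
    rw [hT]
    exact Finset.sum_le_sum fun j _ => by simpa using le_abs_self (A β j)
  have hbdd : BddAbove ((fun A => ∑ i, T A (fun _ => 1) i * β i) '' 𝒜) := by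
    refine ⟨M, ?_⟩
    rintro _ ⟨A, hA, rfl⟩
    exact (hle A).trans (hM ⟨A, hA, rfl⟩)
  refine ⟨hbdd, le_antisymm (csSup_le (h𝒜ne.image _) ?_) (csSup_le (h𝒜ne.image _) ?_)⟩
  · rintro _ ⟨A, hA, rfl⟩
    let w : Fin q → ℝ := fun j => if 0 ≤ A β j then 1 else -1
    have hw : ∀ j, |w j| = 1 := fun j => by
      by_cases h : 0 ≤ A β j <;> simp [w, h]
    have hwA : ∀ j, w j * A β j = |A β j| := fun j => by
      by_cases h : 0 ≤ A β j
      · simp [w, h, abs_of_nonneg h]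
      · simp [w, h, abs_of_neg (not_le.mp h)]
    obtain ⟨B, hB, hBA⟩ : T A w ∈ (fun A => T A (fun _ => 1)) '' 𝒜 :=
      hsign w hw ▸ ⟨A, hA, rfl⟩
    refine le_csSup hbdd ⟨B, hB, ?_⟩
    dsimp only at hBA ⊢
    rw [hBA, hT]
    exact Finset.sum_congr rfl fun j _ => hwA j
  · rintro _ ⟨A, hA, rfl⟩
    exact (hle A).trans (le_csSup ⟨M, hM⟩ ⟨A, hA, rfl⟩)
end

section
/- Gaussian complexity of the ℓ₁ dual certificate set: let S ⊆ Fin p be nonempty with 2·|S| ≤ p, let λ > 0 and κ > 0, and let w ∈ ℝ^p with w_j = 0 for all j ∉ S. Then inf over γ > 0 of ∫ ( inf over b ∈ ℝ^p with ‖b‖_∞ ≤ 1 of ‖γ·λ·(w + κ·b_{Sᶜ}) − ε‖₂² ) dμ(ε) ≤ 2·|S| + (2·ln(p/|S| − 1)/κ²)·‖w‖₂². -/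
open MeasureTheory ProbabilityTheory

lemma integrable_max_sub_zero_sq_gaussianReal (t : ℝ) :
    Integrable (fun x => max (x - t) 0 ^ 2) (gaussianReal 0 1) := by
  have h : MemLp (fun x : ℝ => x - t) 2 (gaussianReal 0 1) :=
    (memLp_id_gaussianReal' 2 (by simp)).sub (memLp_const t)
  exact h.pos_part.integrable_sq

lemma integral_comp_neg_gaussianReal (f : ℝ → ℝ) :
    ∫ x, f (-x) ∂gaussianReal 0 1 = ∫ x, f x ∂gaussianReal 0 1 := by
  have h := (MeasurableEquiv.neg ℝ).measurableEmbedding.integral_map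
    (μ := gaussianReal 0 1) f
  have hm : (gaussianReal 0 1).map (MeasurableEquiv.neg ℝ) = gaussianReal 0 1 := by
    simpa using gaussianReal_map_neg (μ := 0) (v := 1)
  rw [hm] at h
  exact h.symm

lemma integrable_comp_neg_gaussianReal {f : ℝ → ℝ} (hf : Integrable f (gaussianReal 0 1)) :
    Integrable (fun x => f (-x)) (gaussianReal 0 1) := by
  have hm : (gaussianReal 0 1).map (fun x => -x) = gaussianReal 0 1 := by
    simpa using gaussianReal_map_neg (μ := 0) (v := 1)
  rw [← hm] at hf
  exact hf.comp_measurable measurable_neg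

lemma max_abs_sub_zero_sq_eq {t : ℝ} (ht : 0 ≤ t) (x : ℝ) :
    max (|x| - t) 0 ^ 2 = max (x - t) 0 ^ 2 + max (-x - t) 0 ^ 2 := by
  rcases le_total 0 x with hx | hx
  · rw [abs_of_nonneg hx, max_eq_right (a := -x - t) (by linarith)]
    ring
  · rw [abs_of_nonpos hx, max_eq_right (a := x - t) (by linarith)]
    ring

lemma integrable_max_abs_sub_zero_sq_gaussianReal {t : ℝ} (ht : 0 ≤ t) :
    Integrable (fun x => max (|x| - t) 0 ^ 2) (gaussianReal 0 1) := by
  simp_rw [max_abs_sub_zero_sq_eq ht]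
  have h := integrable_max_sub_zero_sq_gaussianReal t
  exact h.add (integrable_comp_neg_gaussianReal h)

lemma integral_max_abs_sub_zero_sq_gaussianReal {t : ℝ} (ht : 0 ≤ t) :
    ∫ x, max (|x| - t) 0 ^ 2 ∂gaussianReal 0 1 =
      2 * ∫ x, max (x - t) 0 ^ 2 ∂gaussianReal 0 1 := by
  simp_rw [max_abs_sub_zero_sq_eq ht]
  have h := integrable_max_sub_zero_sq_gaussianReal t
  rw [integral_add h (integrable_comp_neg_gaussianReal h),
    integral_comp_neg_gaussianReal fun x => max (x - t) 0 ^ 2]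
  ring

lemma integral_sq_gaussianReal : ∫ x, x ^ 2 ∂gaussianReal 0 1 = 1 := by
  have h := variance_fun_id_gaussianReal (μ := 0) (v := 1)
  rw [variance_of_integral_eq_zero (by fun_prop) (by simp)] at h
  simpa using h

lemma integral_max_sub_zero_sq_gaussianReal_le {t : ℝ} (ht : 0 ≤ t) :
    ∫ x, max (x - t) 0 ^ 2 ∂gaussianReal 0 1 ≤
      Real.exp (-t ^ 2 / 2) * ∫ x, max (x - 0) 0 ^ 2 ∂gaussianReal 0 1 := by
  have hint := integrable_max_sub_zero_sq_gaussianReal 0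
  rw [gaussianReal_of_var_ne_zero 0 one_ne_zero, integrable_withDensity_iff_integrable_smul'
    (measurable_gaussianPDF 0 1) (by simp [gaussianPDF_lt_top])] at hint
  simp_rw [toReal_gaussianPDF, smul_eq_mul] at hint
  rw [integral_gaussianReal_eq_integral_smul one_ne_zero,
    integral_gaussianReal_eq_integral_smul one_ne_zero, ← integral_const_mul,
    ← integral_add_right_eq_self _ t]
  refine integral_mono_of_nonneg (.of_forall fun x => ?_) (hint.const_mul _)
    (.of_forall fun x => ?_)
  · exact smul_nonneg (gaussianPDFReal_nonneg _ _ _) (sq_nonneg _)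
  · simp only [smul_eq_mul, add_sub_cancel_right, sub_zero, gaussianPDFReal_def]
    rcases le_total x 0 with hx | hx
    · simp [max_eq_right hx]
    · have hexp : Real.exp (-(x + t) ^ 2 / 2) ≤
          Real.exp (-t ^ 2 / 2) * Real.exp (-x ^ 2 / 2) := by
        rw [← Real.exp_add]
        gcongr
        nlinarith [mul_nonneg hx ht]
      have hc : 0 ≤ (√(2 * Real.pi))⁻¹ * max x 0 ^ 2 := by positivity
      have h := mul_le_mul_of_nonneg_left hexp hc
      simp only [NNReal.coe_one, mul_one]
      linarith

lemma integral_max_abs_sub_zero_sq_gaussianReal_le {t : ℝ} (ht : 0 ≤ t) :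
    ∫ x, max (|x| - t) 0 ^ 2 ∂gaussianReal 0 1 ≤ Real.exp (-t ^ 2 / 2) := by
  have h0 := integral_max_abs_sub_zero_sq_gaussianReal le_rfl
  have habs : ∀ x : ℝ, max (|x| - 0) 0 ^ 2 = x ^ 2 := fun x => by simp
  simp_rw [habs, integral_sq_gaussianReal] at h0
  rw [integral_max_abs_sub_zero_sq_gaussianReal ht]
  have h := integral_max_sub_zero_sq_gaussianReal_le ht
  have he := Real.exp_pos (-t ^ 2 / 2)
  nlinarith

/-- The squared distance from `x` to the interval `[-t, t]` is attained. -/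
lemma exists_abs_le_one_mul_sub_sq_eq {t : ℝ} (ht : 0 < t) (x : ℝ) :
    ∃ b : ℝ, |b| ≤ 1 ∧ (t * b - x) ^ 2 = max (|x| - t) 0 ^ 2 := by
  by_cases hx : |x| ≤ t
  · refine ⟨x / t, ?_, ?_⟩
    · rwa [abs_div, abs_of_pos ht, div_le_one ht]
    · rw [max_eq_right (by linarith), mul_div_cancel₀ _ ht.ne']
      ring
  · push Not at hx
    rw [max_eq_left (by linarith)]
    rcases le_total 0 x with h | h
    · exact ⟨1, by simp, by rw [abs_of_nonneg h]; ring⟩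
    · exact ⟨-1, by simp, by rw [abs_of_nonpos h]; ring⟩

lemma integrable_sub_sq_gaussianReal (a : ℝ) :
    Integrable (fun x => (a - x) ^ 2) (gaussianReal 0 1) :=
  ((memLp_const a).sub (memLp_id_gaussianReal' 2 (by simp))).integrable_sq

lemma integral_sub_sq_gaussianReal (a : ℝ) :
    ∫ x, (a - x) ^ 2 ∂gaussianReal 0 1 = a ^ 2 + 1 := by
  have hid : Integrable (fun x : ℝ => x) (gaussianReal 0 1) :=
    (memLp_id_gaussianReal 1).integrable (by simp)
  have hsq : Integrable (fun x : ℝ => x ^ 2) (gaussianReal 0 1) := by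
    simpa using integrable_sub_sq_gaussianReal 0
  have h : ∀ x : ℝ, (a - x) ^ 2 = a ^ 2 - 2 * a * x + x ^ 2 := fun x => by ring
  simp_rw [h]
  have hlin : Integrable (fun x : ℝ => a ^ 2 - 2 * a * x) (gaussianReal 0 1) :=
    (integrable_const _).sub (hid.const_mul _)
  rw [integral_add hlin hsq,
    integral_sub (integrable_const _) (hid.const_mul _), integral_const_mul,
    integral_sq_gaussianReal]
  simp

/-- The expected squared distance of a standard Gaussian vector to the certificate set scaled
by `c`. -/
lemma integral_sInf_sq_dist_certificates_le {p : ℕ} (S : Finset (Fin p)) {c κ : ℝ} (hc : 0 < c) (hκ : 0 < κ)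
    {w : Fin p → ℝ} (hw : ∀ j ∉ S, w j = 0) :
    ∫ ε, sInf {y : ℝ | ∃ b : Fin p → ℝ, (∀ j, |b j| ≤ 1) ∧
        y = ∑ i, (c * (w i + κ * (if i ∈ S then 0 else b i)) - ε i) ^ 2}
        ∂Measure.pi (fun _ : Fin p => gaussianReal 0 1) ≤
      S.card + c ^ 2 * ∑ i, w i ^ 2 +
        ((p : ℝ) - S.card) * Real.exp (-(c * κ) ^ 2 / 2) := by
  have ht : 0 < c * κ := mul_pos hc hκ
  let f : Fin p → ℝ → ℝ := fun i x =>
    if i ∈ S then (c * w i - x) ^ 2 else max (|x| - c * κ) 0 ^ 2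
  have hf : ∀ i, Integrable (f i) (gaussianReal 0 1) := fun i => by
    by_cases hi : i ∈ S
    · simpa only [f, hi, if_true] using integrable_sub_sq_gaussianReal (c * w i)
    · simpa only [f, hi, if_false] using integrable_max_abs_sub_zero_sq_gaussianReal ht.le
  have hfi : ∀ i, Integrable (fun ε : Fin p → ℝ => f i (ε i))
      (Measure.pi fun _ : Fin p => gaussianReal 0 1) := fun i =>
    integrable_comp_eval (μ := fun _ : Fin p => gaussianReal 0 1) (hf i)
  have hbound : ∀ i, ∫ x, f i x ∂gaussianReal 0 1 ≤
      c ^ 2 * w i ^ 2 + if i ∈ S then 1 else Real.exp (-(c * κ) ^ 2 / 2) := fun i => by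
    by_cases hi : i ∈ S
    · simp only [f, hi, if_true, integral_sub_sq_gaussianReal]
      exact (by ring : _ = _).le
    · simp only [f, hi, if_false, hw i hi]
      simpa using integral_max_abs_sub_zero_sq_gaussianReal_le ht.le
  calc
    _ ≤ ∫ ε, ∑ i, f i (ε i) ∂Measure.pi (fun _ : Fin p => gaussianReal 0 1) := by
      refine integral_mono_of_nonneg (.of_forall fun ε => ?_)
        (integrable_finsetSum _ fun i _ => hfi i) (.of_forall fun ε => ?_)
      · apply Real.sInf_nonneg
        rintro _ ⟨b, -, rfl⟩
        positivity
      · choose b hb hbε using fun i => exists_abs_le_one_mul_sub_sq_eq ht (ε i)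
        refine csInf_le ⟨0, ?_⟩ ⟨b, hb, Finset.sum_congr rfl fun i _ => ?_⟩
        · rintro _ ⟨b, -, rfl⟩
          positivity
        · by_cases hi : i ∈ S
          · simp [f, hi]
          · simp only [f, hi, if_false, hw i hi, ← hbε]
            ring
    _ = ∑ i, ∫ x, f i x ∂gaussianReal 0 1 := by
      rw [integral_finsetSum _ fun i _ => hfi i]
      exact Finset.sum_congr rfl fun i _ =>
        integral_comp_eval (μ := fun _ : Fin p => gaussianReal 0 1) (hf i).aestronglyMeasurable
    _ ≤ ∑ i, (c ^ 2 * w i ^ 2 + if i ∈ S then 1 else Real.exp (-(c * κ) ^ 2 / 2)) :=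
      Finset.sum_le_sum fun i _ => hbound i
    _ = _ := by
      have hcard : ((Finset.univ.filter fun i => i ∉ S).card : ℝ) = p - S.card := by
        rw [Finset.filter_notMem_eq_sdiff, ← Finset.compl_eq_univ_sdiff, Finset.card_compl,
          Nat.cast_sub (Finset.card_le_univ S), Fintype.card_fin]
      rw [Finset.sum_add_distrib, ← Finset.mul_sum, Finset.sum_ite, Finset.sum_const,
        Finset.sum_const, nsmul_eq_mul, nsmul_eq_mul, hcard, Finset.filter_mem_eq_inter,
        Finset.univ_inter]
      ring



/-- Gaussian complexity of the ℓ₁ dual certificate set: for a nonempty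
`S ⊆ Fin p` with `2·|S| ≤ p`, `λ > 0`, `κ > 0` and `w` supported on `S`,
`inf_{γ>0} ∫ inf_{‖b‖_∞ ≤ 1} ‖γ·λ·(w + κ·b_{Sᶜ}) − ε‖₂² dμ(ε)
  ≤ 2|S| + (2·ln(p/|S| − 1)/κ²)·‖w‖₂²`. -/
theorem stmt16 (p : ℕ)
    (μ : Measure (Fin p → ℝ))
    (hμ : μ = Measure.pi fun _ : Fin p => gaussianReal 0 1)
    (S : Finset (Fin p)) (hSne : S.Nonempty) (hScard : 2 * S.card ≤ p)
    (lam κ : ℝ) (hlam : 0 < lam) (hκ : 0 < κ)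
    (w : Fin p → ℝ) (hw : ∀ j ∉ S, w j = 0) :
    sInf {x : ℝ | ∃ γ : ℝ, 0 < γ ∧
        x = ∫ ε, sInf {y : ℝ | ∃ b : Fin p → ℝ, (∀ j, |b j| ≤ 1) ∧
              y = ∑ i, (γ * lam * (w i + κ * (if i ∈ S then 0 else b i)) - ε i) ^ 2} ∂μ}
      ≤ 2 * S.card + (2 * Real.log ((p : ℝ) / (S.card : ℝ) - 1) / κ ^ 2) * ∑ i, w i ^ 2 := by
  subst hμ
  have hs : (0 : ℝ) < S.card := by exact_mod_cast hSne.card_pos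
  have hp : 2 * (S.card : ℝ) ≤ p := by exact_mod_cast hScard
  have hratio : 1 ≤ (p : ℝ) / S.card - 1 := by
    rw [le_sub_iff_add_le, le_div_iff₀ hs]
    linarith
  set L := Real.log ((p : ℝ) / S.card - 1) with hL
  have hL0 : 0 ≤ L := Real.log_nonneg hratio
  set c₀ := √(2 * L) / κ with hc₀
  have hc₀0 : 0 ≤ c₀ := by positivity
  have hsq : c₀ ^ 2 = 2 * L / κ ^ 2 := by
    rw [hc₀, div_pow, Real.sq_sqrt (by positivity)]
  have hexp : ((p : ℝ) - S.card) * Real.exp (-(c₀ * κ) ^ 2 / 2) = S.card := by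
    have h : -(c₀ * κ) ^ 2 / 2 = -L := by
      rw [mul_pow, hsq]
      field_simp
    rw [h, Real.exp_neg, hL, Real.exp_log (by linarith)]
    have h' : (p : ℝ) - S.card ≠ 0 := by linarith
    field_simp
  let F : ℝ → ℝ := fun c => S.card + c ^ 2 * ∑ i, w i ^ 2 +
    ((p : ℝ) - S.card) * Real.exp (-(c * κ) ^ 2 / 2)
  have hF : Continuous F := by fun_prop
  have hF₀ : F c₀ = 2 * S.card + (2 * L / κ ^ 2) * ∑ i, w i ^ 2 := by
    simp only [F, hexp, hsq]
    ring
  rw [← hF₀]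
  -- The optimal scale is zero when `p = 2 * S.card`, so it is approached from the right.
  refine ge_of_tendsto (hF.continuousWithinAt (s := Set.Ioi c₀)) ?_
  filter_upwards [self_mem_nhdsWithin] with c hc
  have hc0 : 0 < c := hc₀0.trans_lt hc
  refine le_trans (csInf_le ⟨0, ?_⟩ ⟨c / lam, div_pos hc0 hlam, rfl⟩) ?_
  · rintro _ ⟨γ, -, rfl⟩
    refine integral_nonneg fun ε => Real.sInf_nonneg ?_
    rintro _ ⟨b, -, rfl⟩
    positivity
  · rw [div_mul_cancel₀ c hlam.ne']
    exact integral_sInf_sq_dist_certificates_le S hc0 hκ hw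
end

section
/- Gaussian complexity of the group-ℓ₁ dual certificate set: let S ⊆ Fin q be nonempty with 2·|S| ≤ q, let λ > 0 and κ > 0, and let w ∈ ℝ^p with w_i = 0 for all i ∉ 𝐒. Then inf over γ > 0 of ∫ ( inf over b ∈ ℝ^p with ‖b‖_{Γ,∞} ≤ 1 of ‖γ·λ·(w + κ·b_{𝐒ᶜ}) − ε‖₂² ) dμ(ε) ≤ |S|·(m+1) + ((√(2·ln(q/|S| − 1)) + √m)²/κ²)·‖w‖₂². -/
open MeasureTheory ProbabilityTheory

/-- Pointwise Chernoff-type domination of the squared excess of a radius `r` over `n + d - d⁻¹`. -/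
lemma sq_sub_le_exp (n d r : ℝ) (hn : 0 < n) (hd : 1 ≤ d) (hr : n + (d - d⁻¹) ≤ r) :
    (r - (n + (d - d⁻¹))) ^ 2 ≤
      Real.exp ((1 - (n / (n + d)) ^ 2) / 2 * r ^ 2 - (d - d⁻¹) ^ 2 / 2 - n * d) := by
  have hd0 : 0 < d := by linarith
  obtain ⟨y, rfl⟩ : ∃ y, r = n + d + y := ⟨r - (n + d), by ring⟩
  set c := d⁻¹
  have hdc : d * c = 1 := mul_inv_cancel₀ hd0.ne'
  have hc0 : 0 < c := by positivity
  have hc1 : c ≤ 1 := inv_le_one_of_one_le₀ hd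
  set k := n / (n + d) with hk
  have hk0 : 0 < k := by positivity
  have hk1 : k < 1 := by rw [hk, div_lt_one (by positivity)]; linarith
  have hkn : k * (n + d) = n := div_mul_cancel₀ _ (by positivity)
  have hexp : (1 - k ^ 2) / 2 * (n + d + y) ^ 2 - (d - c) ^ 2 / 2 - n * d
      = (1 - c ^ 2 / 2) + d * (1 + k) * y + (1 - k ^ 2) / 2 * y ^ 2 := by
    have e1 : k * d = n - k * n := by linarith
    have e2 : k ^ 2 * (n + d) ^ 2 = n ^ 2 := by rw [← mul_pow, hkn]
    have e3 : k ^ 2 * (n + d) = k * n := by rw [pow_two, mul_assoc, hkn]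
    linear_combination (-1 / 2) * e2 - y * e3 + hdc - y * e1
  rw [hexp]
  have hx : n + d + y - (n + (d - c)) = c * (1 + d * y) := by
    linear_combination (-y) * hdc
  have hx0 : 0 ≤ 1 + d * y := by
    have : 0 ≤ c * (1 + d * y) := by rw [← hx]; linarith
    exact nonneg_of_mul_nonneg_right this hc0
  rw [hx, mul_pow]
  have hc2 : c ^ 2 ≤ 1 := pow_le_one₀ hc0.le hc1
  have hquad : 0 ≤ (1 - k ^ 2) / 2 * y ^ 2 := by
    have : k ^ 2 ≤ 1 := pow_le_one₀ hk0.le hk1.le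
    have := sub_nonneg.2 this
    positivity
  refine (mul_le_of_le_one_left (sq_nonneg _) hc2).trans ?_
  rcases le_total 0 y with hy | hy
  · have hlin : 0 ≤ d * k * y := by positivity
    have h1 : (1 + d * y) / 2 ≤ Real.exp ((d * y - 1) / 2) := by
      have := Real.add_one_le_exp ((d * y - 1) / 2)
      linarith
    have h2 : (2 : ℝ) ≤ Real.exp (3 / 4) := by
      have h := Real.quadratic_le_exp_of_nonneg (show (0 : ℝ) ≤ 3 / 4 by norm_num)
      norm_num at h
      linarith
    calc (1 + d * y) ^ 2 = (2 * ((1 + d * y) / 2)) ^ 2 := by ring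
      _ ≤ (Real.exp (3 / 4) * Real.exp ((d * y - 1) / 2)) ^ 2 := by gcongr
      _ = Real.exp (1 / 2 + d * y) := by
          rw [← Real.exp_add, ← Real.exp_nat_mul]; congr 1; push_cast; ring
      _ ≤ _ := Real.exp_le_exp.2 (by linarith)
  · have hlin : d * (1 - k) * y ≤ 0 :=
      mul_nonpos_of_nonneg_of_nonpos (mul_nonneg hd0.le (by linarith)) hy
    calc (1 + d * y) ^ 2 ≤ (Real.exp (d * y)) ^ 2 := by
          gcongr; linarith [Real.add_one_le_exp (d * y)]
      _ = Real.exp (2 * (d * y)) := by rw [← Real.exp_nat_mul]; norm_num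
      _ ≤ _ := Real.exp_le_exp.2 (by linarith)

/-- The inequality `((n + d) / n) ^ (n ^ 2) ≤ exp (n * d)` at `n = √m`. -/
lemma sqrt_ratio_pow_le_exp (m : ℕ) (hm : 1 ≤ m) (d : ℝ) (hd : 0 ≤ d) :
    ((Real.sqrt m + d) / Real.sqrt m) ^ m ≤ Real.exp (Real.sqrt m * d) := by
  have hn : 0 < Real.sqrt m := Real.sqrt_pos.2 (by exact_mod_cast hm)
  have h : (Real.sqrt m + d) / Real.sqrt m ≤ Real.exp (d / Real.sqrt m) := by
    rw [add_div, div_self hn.ne', add_comm]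
    exact Real.add_one_le_exp _
  calc _ ≤ (Real.exp (d / Real.sqrt m)) ^ m := by gcongr
    _ = _ := by
      rw [← Real.exp_nat_mul]
      congr 1
      nth_rewrite 1 [← Real.sq_sqrt (Nat.cast_nonneg (α := ℝ) m)]
      field_simp

/-- The moment generating function of the square of a standard Gaussian, parametrised so that
the exponent is `(1 - k ^ 2) / 2`. -/
lemma integral_exp_mul_sq_gaussianReal (k : ℝ) (hk : 0 < k) :
    Integrable (fun x => Real.exp ((1 - k ^ 2) / 2 * x ^ 2)) (gaussianReal 0 1) ∧
      ∫ x, Real.exp ((1 - k ^ 2) / 2 * x ^ 2) ∂gaussianReal 0 1 = k⁻¹ := by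
  have key : ∀ x : ℝ, gaussianPDFReal 0 1 x * Real.exp ((1 - k ^ 2) / 2 * x ^ 2)
      = (Real.sqrt (2 * Real.pi))⁻¹ * Real.exp (-(k ^ 2 / 2) * x ^ 2) := by
    intro x
    rw [gaussianPDFReal, mul_assoc, ← Real.exp_add]
    simp only [NNReal.coe_one, mul_one, sub_zero]
    congr 2
    ring
  constructor
  · rw [gaussianReal_of_var_ne_zero _ one_ne_zero,
      integrable_withDensity_iff (measurable_gaussianPDF _ _)
        (Filter.Eventually.of_forall fun _ => gaussianPDF_lt_top)]
    simp only [toReal_gaussianPDF]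
    refine ((integrable_exp_neg_mul_sq (b := k ^ 2 / 2) (by positivity)).const_mul
      (Real.sqrt (2 * Real.pi))⁻¹).congr (Filter.Eventually.of_forall fun x => ?_)
    simp only
    rw [← key x, mul_comm]
  · rw [integral_gaussianReal_eq_integral_smul one_ne_zero]
    simp only [smul_eq_mul, key]
    rw [integral_const_mul, integral_gaussian]
    have : Real.pi / (k ^ 2 / 2) = (2 * Real.pi) / k ^ 2 := by field_simp
    rw [this, Real.sqrt_div (by positivity), Real.sqrt_sq hk.le]
    have : Real.sqrt (2 * Real.pi) ≠ 0 := by positivity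
    field_simp

lemma integral_const_sub_sq_gaussianReal (a : ℝ) :
    Integrable (fun x => (a - x) ^ 2) (gaussianReal 0 1) ∧
      ∫ x, (a - x) ^ 2 ∂gaussianReal 0 1 = a ^ 2 + 1 := by
  have h1 : Integrable (fun x : ℝ => x) (gaussianReal 0 1) :=
    (memLp_id_gaussianReal (μ := 0) (v := 1) 1).integrable (by simp)
  have h2 : Integrable (fun x : ℝ => x ^ 2) (gaussianReal 0 1) :=
    (memLp_id_gaussianReal (μ := 0) (v := 1) 2).integrable_sq
  have hv : ∫ x : ℝ, x ^ 2 ∂gaussianReal 0 1 = 1 := by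
    have := variance_fun_id_gaussianReal (μ := 0) (v := 1)
    rw [variance_eq_integral (by fun_prop)] at this
    simpa using this
  have hrw : (fun x : ℝ => (a - x) ^ 2) = fun x => (a ^ 2 - 2 * a * x) + x ^ 2 := by
    ext x; ring
  have h3 : Integrable (fun x : ℝ => a ^ 2 - 2 * a * x) (gaussianReal 0 1) :=
    (integrable_const _).sub (h1.const_mul _)
  refine ⟨hrw ▸ h3.add h2, ?_⟩
  rw [hrw, integral_add h3 h2, integral_sub (integrable_const _) (h1.const_mul _),
    integral_const_mul, hv]
  simp

lemma integral_exp_mul_sum_sq_pi {p : ℕ} (G : Finset (Fin p)) (k : ℝ) (hk : 0 < k) :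
    Integrable (fun ε : Fin p → ℝ => Real.exp ((1 - k ^ 2) / 2 * ∑ i ∈ G, ε i ^ 2))
        (Measure.pi fun _ => gaussianReal 0 1) ∧
      ∫ ε : Fin p → ℝ, Real.exp ((1 - k ^ 2) / 2 * ∑ i ∈ G, ε i ^ 2)
        ∂(Measure.pi fun _ => gaussianReal 0 1) = k⁻¹ ^ G.card := by
  let f : Fin p → ℝ → ℝ := fun i x => if i ∈ G then Real.exp ((1 - k ^ 2) / 2 * x ^ 2) else 1
  have hrw : (fun ε : Fin p → ℝ => Real.exp ((1 - k ^ 2) / 2 * ∑ i ∈ G, ε i ^ 2))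
      = fun ε => ∏ i, f i (ε i) := by
    ext ε
    simp only [f]
    rw [Finset.mul_sum, Real.exp_sum, Finset.prod_ite_mem, Finset.univ_inter]
  have h := integral_exp_mul_sq_gaussianReal k hk
  rw [hrw]
  constructor
  · refine Integrable.fintype_prod (f := f) fun i => ?_
    by_cases hi : i ∈ G
    · simpa [f, hi] using h.1
    · simp [f, hi]
  · rw [integral_fintype_prod_eq_prod (f := f)]
    have : ∀ i : Fin p, ∫ x, f i x ∂gaussianReal 0 1 = if i ∈ G then k⁻¹ else 1 := by
      intro i
      by_cases hi : i ∈ G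
      · simpa [f, hi] using h.2
      · simp [f, hi]
    simp only [this, Finset.prod_ite_mem, Finset.univ_inter, Finset.prod_const]

lemma integral_const_sub_sq_pi {p : ℕ} (i : Fin p) (a : ℝ) :
    Integrable (fun ε : Fin p → ℝ => (a - ε i) ^ 2) (Measure.pi fun _ => gaussianReal 0 1) ∧
      ∫ ε : Fin p → ℝ, (a - ε i) ^ 2 ∂(Measure.pi fun _ => gaussianReal 0 1) = a ^ 2 + 1 := by
  have h := integral_const_sub_sq_gaussianReal a
  have hmp := measurePreserving_eval (fun _ : Fin p => gaussianReal 0 1) i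
  refine ⟨hmp.integrable_comp_of_integrable h.1, ?_⟩
  have hc : AEStronglyMeasurable (fun x : ℝ => (a - x) ^ 2)
      ((Measure.pi fun _ : Fin p => gaussianReal 0 1).map (Function.eval i)) :=
    Continuous.aestronglyMeasurable (by fun_prop)
  have hmap := integral_map hmp.aemeasurable hc
  rw [hmp.map_eq, h.2] at hmap
  exact hmap.symm

/-- The squared distance from `ε`, restricted to `G`, to the Euclidean ball of radius `T` is bounded
by `f (‖ε‖²)` as soon as `f (r²)` dominates the squared excess `(r - T)²` for `r ≥ T`. -/
lemma exists_scaled_ball_approx {ι : Type*} (G : Finset ι) (ε : ι → ℝ) (T : ℝ) (hT : 0 < T)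
    (f : ℝ → ℝ) (hf : ∀ r, 0 ≤ f r) (hle : ∀ r, T ≤ r → (r - T) ^ 2 ≤ f (r ^ 2)) :
    ∃ b : ι → ℝ, Real.sqrt (∑ i ∈ G, b i ^ 2) ≤ 1 ∧
      ∑ i ∈ G, (T * b i - ε i) ^ 2 ≤ f (∑ i ∈ G, ε i ^ 2) := by
  have hsum : 0 ≤ ∑ i ∈ G, ε i ^ 2 := Finset.sum_nonneg fun _ _ => sq_nonneg _
  set N := Real.sqrt (∑ i ∈ G, ε i ^ 2)
  have hN2 : ∑ i ∈ G, ε i ^ 2 = N ^ 2 := (Real.sq_sqrt hsum).symm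
  have hN0 : 0 ≤ N := Real.sqrt_nonneg _
  have hmax : 0 < max N T := lt_max_of_lt_right hT
  refine ⟨fun i => ε i / max N T, ?_, ?_⟩
  · rw [Real.sqrt_le_one]
    simp only [div_pow, ← Finset.sum_div]
    rw [hN2, div_le_one (by positivity)]
    gcongr
    exact le_max_left _ _
  · have : ∀ i, (T * (ε i / max N T) - ε i) ^ 2 = (T / max N T - 1) ^ 2 * ε i ^ 2 := by
      intro i; ring
    simp only [this, ← Finset.mul_sum]
    rw [hN2]
    rcases le_total N T with h | h
    · rw [max_eq_right h, div_self hT.ne']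
      simpa using hf _
    · rw [max_eq_left h]
      have hNpos : 0 < N := hT.trans_le h
      convert hle N h using 1
      field_simp
      ring

lemma exists_one_le_sub_inv_eq (u : ℝ) (hu : 0 ≤ u) : ∃ d : ℝ, 1 ≤ d ∧ d - d⁻¹ = u := by
  have hs : Real.sqrt (u ^ 2 + 4) ^ 2 = u ^ 2 + 4 := Real.sq_sqrt (by positivity)
  have h2 : 2 ≤ Real.sqrt (u ^ 2 + 4) := Real.le_sqrt_of_sq_le (by nlinarith)
  have hd : 0 < (u + Real.sqrt (u ^ 2 + 4)) / 2 := by linarith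
  refine ⟨(u + Real.sqrt (u ^ 2 + 4)) / 2, by linarith, ?_⟩
  rw [sub_eq_iff_eq_add, ← sub_eq_iff_eq_add']
  apply eq_inv_of_mul_eq_one_left
  linear_combination hs / 4

/-- Exponential domination of the squared excess over `√(2 ln t) + √m`, with a constant calibrated
against the moment generating function of a chi-square variable with `m` degrees of freedom. -/
lemma exists_exp_domination (m : ℕ) (hm : 1 ≤ m) (t : ℝ) (ht : 1 ≤ t) :
    ∃ k A : ℝ, 0 < k ∧ 0 ≤ A ∧ A * k⁻¹ ^ m ≤ t⁻¹ ∧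
      ∀ r, Real.sqrt (2 * Real.log t) + Real.sqrt m ≤ r →
        (r - (Real.sqrt (2 * Real.log t) + Real.sqrt m)) ^ 2
          ≤ A * Real.exp ((1 - k ^ 2) / 2 * r ^ 2) := by
  obtain ⟨d, hd, hdu⟩ := exists_one_le_sub_inv_eq _ (Real.sqrt_nonneg (2 * Real.log t))
  have hn : 0 < Real.sqrt m := Real.sqrt_pos.2 (by exact_mod_cast hm)
  have ht0 : 0 < t := by linarith
  have hd0 : 0 < d := by linarith
  have hu2 : (d - d⁻¹) ^ 2 = 2 * Real.log t := by
    rw [hdu, Real.sq_sqrt (by have := Real.log_nonneg ht; positivity)]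
  refine ⟨Real.sqrt m / (Real.sqrt m + d), Real.exp (-Real.log t - Real.sqrt m * d),
    by positivity, by positivity, ?_, ?_⟩
  · rw [inv_div]
    calc _ ≤ Real.exp (-Real.log t - Real.sqrt m * d) * Real.exp (Real.sqrt m * d) := by
          gcongr
          exact sqrt_ratio_pow_le_exp m hm d hd0.le
      _ = t⁻¹ := by
          rw [← Real.exp_add, sub_add_cancel, Real.exp_neg, Real.exp_log ht0]
  · intro r hr
    rw [← hdu, add_comm] at hr ⊢
    refine (sq_sub_le_exp _ d r hn hd hr).trans_eq ?_
    rw [← Real.exp_add, hu2]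
    congr 1
    ring

/-- Gaussian complexity of the group-ℓ₁ dual certificate set: with `p = q·m`,
groups `Γ_j` (`j ∈ Fin q`) partitioning `Fin p` with `|Γ_j| = m`, a nonempty `S ⊆ Fin q`
with `2·|S| ≤ q`, `λ > 0`, `κ > 0`, and `w` supported on `𝐒 = ⋃_{j ∈ S} Γ_j`,
`inf_{γ>0} ∫ inf_{‖b‖_{Γ,∞} ≤ 1} ‖γ·λ·(w + κ·b_{𝐒ᶜ}) − ε‖₂² dμ(ε)
  ≤ |S|(m+1) + ((√(2·ln(q/|S| − 1)) + √m)²/κ²)·‖w‖₂²`. -/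
theorem stmt17 (m q p : ℕ) (hm : 1 ≤ m) (hp : p = q * m)
    (μ : Measure (Fin p → ℝ))
    (hμ : μ = Measure.pi fun _ : Fin p => gaussianReal 0 1)
    (Γ : Fin q → Finset (Fin p))
    (hΓcard : ∀ j, (Γ j).card = m)
    (hΓdisj : ∀ j k, j ≠ k → Disjoint (Γ j) (Γ k))
    (hΓcover : ∀ i : Fin p, ∃ j, i ∈ Γ j)
    (S : Finset (Fin q)) (hSne : S.Nonempty) (hScard : 2 * S.card ≤ q)
    (lam κ : ℝ) (hlam : 0 < lam) (hκ : 0 < κ)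
    (w : Fin p → ℝ) (hw : ∀ i ∉ S.biUnion Γ, w i = 0) :
    sInf {x : ℝ | ∃ γ : ℝ, 0 < γ ∧
        x = ∫ ε, sInf {y : ℝ | ∃ b : Fin p → ℝ,
              (∀ j : Fin q, Real.sqrt (∑ i ∈ Γ j, b i ^ 2) ≤ 1) ∧
              y = ∑ i, (γ * lam * (w i + κ * (if i ∈ S.biUnion Γ then 0 else b i)) - ε i) ^ 2} ∂μ}
      ≤ (S.card : ℝ) * ((m : ℝ) + 1)
        + ((Real.sqrt (2 * Real.log ((q : ℝ) / (S.card : ℝ) - 1)) + Real.sqrt m) ^ 2 / κ ^ 2)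
          * ∑ i, w i ^ 2 := by
  subst hμ
  have hs : (0 : ℝ) < S.card := by exact_mod_cast hSne.card_pos
  have hq : 2 * (S.card : ℝ) ≤ q := by exact_mod_cast hScard
  have ht : 1 ≤ (q : ℝ) / S.card - 1 := by
    have : 2 ≤ (q : ℝ) / S.card := (le_div_iff₀ hs).2 hq
    linarith
  obtain ⟨k, A, hk, hA, hAk, hdom⟩ := exists_exp_domination m hm _ ht
  have hn : 0 < Real.sqrt m := Real.sqrt_pos.2 (by exact_mod_cast hm)
  set T := Real.sqrt (2 * Real.log ((q : ℝ) / (S.card : ℝ) - 1)) + Real.sqrt m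
  have hT : 0 < T := add_pos_of_nonneg_of_pos (Real.sqrt_nonneg _) hn
  have hsInf : ∀ (γ : ℝ) (ε : Fin p → ℝ), 0 ≤ sInf {y : ℝ | ∃ b : Fin p → ℝ,
      (∀ j : Fin q, Real.sqrt (∑ i ∈ Γ j, b i ^ 2) ≤ 1) ∧
      y = ∑ i, (γ * lam * (w i + κ * (if i ∈ S.biUnion Γ then 0 else b i)) - ε i) ^ 2} := by
    rintro γ ε
    refine Real.sInf_nonneg ?_
    rintro _ ⟨b, -, rfl⟩
    exact Finset.sum_nonneg fun _ _ => sq_nonneg _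
  have hblocks : ∀ f : Fin p → ℝ, ∑ i, f i = ∑ j, ∑ i ∈ Γ j, f i := by
    intro f
    rw [← Finset.sum_biUnion fun j _ l _ h => hΓdisj j l h]
    congr 1
    ext i
    simpa using hΓcover i
  have hmem : ∀ {i j}, i ∈ Γ j → (i ∈ S.biUnion Γ ↔ j ∈ S) := by
    intro i j hij
    refine ⟨fun h => ?_, fun h => Finset.mem_biUnion.2 ⟨j, h, hij⟩⟩
    obtain ⟨l, hl, hil⟩ := Finset.mem_biUnion.1 h
    by_contra hj
    exact Finset.disjoint_left.1 (hΓdisj l j fun e => hj (e ▸ hl)) hil hij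
  let F : (Fin p → ℝ) → Fin q → ℝ := fun ε j =>
    if j ∈ S then ∑ i ∈ Γ j, (T / κ * w i - ε i) ^ 2
    else A * Real.exp ((1 - k ^ 2) / 2 * ∑ i ∈ Γ j, ε i ^ 2)
  have hFint : ∀ j, Integrable (fun ε => F ε j) (Measure.pi fun _ : Fin p => gaussianReal 0 1) := by
    intro j
    by_cases hj : j ∈ S
    · simp only [F, hj, if_true]
      exact integrable_finsetSum _ fun i _ => (integral_const_sub_sq_pi i _).1
    · simp only [F, hj, if_false]
      exact (integral_exp_mul_sum_sq_pi (Γ j) k hk).1.const_mul A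
  have hFval : ∀ j, ∫ ε, F ε j ∂(Measure.pi fun _ : Fin p => gaussianReal 0 1)
      ≤ T ^ 2 / κ ^ 2 * ∑ i ∈ Γ j, w i ^ 2
        + if j ∈ S then (m : ℝ) else ((q : ℝ) / S.card - 1)⁻¹ := by
    intro j
    by_cases hj : j ∈ S
    · simp only [F, hj, if_true]
      rw [integral_finsetSum _ fun i _ => (integral_const_sub_sq_pi i _).1]
      simp only [(integral_const_sub_sq_pi _ _).2, Finset.sum_add_distrib, mul_pow, div_pow,
        ← Finset.mul_sum, Finset.sum_const, hΓcard, nsmul_eq_mul, mul_one]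
      exact le_rfl
    · simp only [F, hj, if_false]
      rw [integral_const_mul, (integral_exp_mul_sum_sq_pi (Γ j) k hk).2, hΓcard]
      refine hAk.trans (le_add_of_nonneg_left ?_)
      positivity
  have hpoint : ∀ ε : Fin p → ℝ, sInf {y : ℝ | ∃ b : Fin p → ℝ,
      (∀ j : Fin q, Real.sqrt (∑ i ∈ Γ j, b i ^ 2) ≤ 1) ∧
      y = ∑ i, (T / κ / lam * lam * (w i + κ * (if i ∈ S.biUnion Γ then 0 else b i)) - ε i) ^ 2}
      ≤ ∑ j, F ε j := by
    intro ε
    choose b hb1 hb2 using fun j => exists_scaled_ball_approx (Γ j) ε T hT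
      (fun x => A * Real.exp ((1 - k ^ 2) / 2 * x)) (fun _ => by positivity) hdom
    choose g hg using hΓcover
    have hgeq : ∀ {i j}, i ∈ Γ j → g i = j := by
      intro i j hij
      by_contra h
      exact Finset.disjoint_left.1 (hΓdisj _ _ h) (hg i) hij
    refine le_trans (csInf_le ⟨0, ?_⟩ ⟨fun i => b (g i) i, fun j => ?_, rfl⟩) ?_
    · rintro _ ⟨b, -, rfl⟩
      exact Finset.sum_nonneg fun _ _ => sq_nonneg _
    · refine (congrArg Real.sqrt (Finset.sum_congr rfl fun i hi => ?_)).trans_le (hb1 j)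
      simp only [hgeq hi]
    · rw [hblocks]
      refine Finset.sum_le_sum fun j _ => ?_
      rw [div_mul_cancel₀ _ hlam.ne']
      by_cases hj : j ∈ S
      · simp only [F, hj, if_true]
        refine (Finset.sum_congr rfl fun i hi => ?_).le
        simp [(hmem hi).2 hj]
      · simp only [F, hj, if_false]
        refine le_trans (Finset.sum_congr rfl fun i hi => ?_).le (hb2 j)
        have hi' : i ∉ S.biUnion Γ := fun h => hj ((hmem hi).1 h)
        rw [if_neg hi', hw i hi', hgeq hi]
        field_simp
        ring
  refine le_trans (csInf_le ⟨0, ?_⟩ ⟨T / κ / lam, by positivity, rfl⟩) ?_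
  · rintro _ ⟨γ, -, rfl⟩
    exact integral_nonneg (hsInf γ)
  refine (integral_mono_of_nonneg (Filter.Eventually.of_forall (hsInf _))
    (integrable_finsetSum _ fun j _ => hFint j) (Filter.Eventually.of_forall hpoint)).trans ?_
  rw [integral_finsetSum _ fun j _ => hFint j]
  refine (Finset.sum_le_sum fun j _ => hFval j).trans_eq ?_
  rw [Finset.sum_add_distrib, ← Finset.mul_sum, ← hblocks, add_comm]
  congr 1
  rw [Finset.sum_ite, Finset.sum_const, Finset.sum_const, Finset.filter_mem_eq_inter,
    Finset.univ_inter, Finset.filter_not, Finset.filter_mem_eq_inter, Finset.univ_inter,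
    ← Finset.compl_eq_univ_sdiff, Finset.card_compl, Fintype.card_fin, nsmul_eq_mul, nsmul_eq_mul,
    Nat.cast_sub (by omega)]
  have hqs : (q : ℝ) - S.card ≠ 0 := by linarith
  have : (q : ℝ) / S.card - 1 = (q - S.card) / S.card := by field_simp
  rw [this, inv_div]
  field_simp
end

section
/- Restricted convexity lower bounds for generalized linear models: let κ > 0 satisfy |ln ℓ_i''(t) − ln ℓ_i''(s)| ≤ κ·|t − s| for all i and all s, t ∈ ℝ. Let r > 0 and let β ∈ E satisfy 0 < N(β − β̄) ≤ r, and suppose the ray from β̄ through β meets C, i.e., β̄ + t•(β − β̄) ∈ C for some t > 0. Then D_L(β, β̄) ≥ γ₁(β̄; κ·r, C, N) · N(β − β̄)² and D_L(β̄, β) ≥ γ₂(β̄; κ·r, C, N) · N(β − β̄)². -/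
open RealInnerProductSpace

lemma le_of_hasDerivAt_nonneg {φ φ' : ℝ → ℝ} {a b : ℝ} (hab : a ≤ b)
    (hd : ∀ t, HasDerivAt φ (φ' t) t) (h : ∀ t, a ≤ t → t ≤ b → 0 ≤ φ' t) : φ a ≤ φ b := by
  refine monotoneOn_of_deriv_nonneg (convex_Icc a b)
    (fun t _ => (hd t).continuousAt.continuousWithinAt)
    (fun t _ => (hd t).differentiableAt.differentiableWithinAt) ?_
    (Set.left_mem_Icc.2 hab) (Set.right_mem_Icc.2 hab) hab
  intro t ht
  rw [interior_Icc] at ht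
  rw [(hd t).deriv]
  exact h t ht.1.le ht.2.le

/-- Lower bounds for both Bregman divergences of a convex function `g` between `0` and `d ≥ 0`,
when its second derivative is at least `m` on `[0, ρ]`. -/
lemma bregman_lower_bounds_of_nonneg {g g' g'' : ℝ → ℝ}
    (hd1 : ∀ t, HasDerivAt g (g' t) t) (hd2 : ∀ t, HasDerivAt g' (g'' t) t)
    (hpos : ∀ t, 0 < g'' t) {m ρ d : ℝ} (hm : 0 ≤ m) (hρ : 0 ≤ ρ) (hd : 0 ≤ d)
    (hlow : ∀ t, 0 ≤ t → t ≤ ρ → m ≤ g'' t) :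
    m / 2 * min (d ^ 2) (d * ρ) ≤ g d - g 0 - g' 0 * d ∧
      m / 2 * min (d ^ 2) (ρ ^ 2) ≤ g 0 - g d + g' d * d := by
  have hquad : ∀ t : ℝ, HasDerivAt (fun t => m / 2 * t ^ 2) (m * t) t := fun t => by
    refine ((hasDerivAt_pow 2 t).const_mul (m / 2)).congr_deriv ?_
    norm_num
    ring
  have hlin : ∀ k t : ℝ, HasDerivAt (fun t => k * t) k t := fun k t => by
    simpa using (hasDerivAt_id t).const_mul k
  have hslope : ∀ t, 0 ≤ t → t ≤ ρ → m * t ≤ g' t - g' 0 := fun t h0 h1 => by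
    have := le_of_hasDerivAt_nonneg h0 (fun s => (hd2 s).sub (hlin m s))
      (fun s hs0 hs1 => sub_nonneg.2 (hlow s hs0 (hs1.trans h1)))
    simp only [Pi.sub_apply] at this
    linarith
  have hfwd : ∀ t, 0 ≤ t → t ≤ ρ → m / 2 * t ^ 2 ≤ g t - g 0 - g' 0 * t := fun t h0 h1 => by
    have := le_of_hasDerivAt_nonneg h0 (fun s => ((hd1 s).sub (hlin (g' 0) s)).sub (hquad s))
      (fun s hs0 hs1 => by linarith [hslope s hs0 (hs1.trans h1)])
    simp only [Pi.sub_apply] at this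
    linarith
  have hbwd_deriv : ∀ t, HasDerivAt (fun t => g' t * t - g t) (g'' t * t) t := fun t => by
    refine (((hd2 t).mul (hasDerivAt_id t)).sub (hd1 t)).congr_deriv ?_
    simp
  have hbwd : ∀ t, 0 ≤ t → t ≤ ρ → m / 2 * t ^ 2 ≤ g 0 - g t + g' t * t := fun t h0 h1 => by
    have := le_of_hasDerivAt_nonneg h0 (fun s => (hbwd_deriv s).sub (hquad s))
      (fun s hs0 hs1 => by nlinarith [hlow s hs0 (hs1.trans h1)])
    simp only [Pi.sub_apply] at this
    linarith
  rcases le_total d ρ with h | h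
  · exact ⟨(mul_le_mul_of_nonneg_left (min_le_left _ _) (by positivity)).trans (hfwd d hd h),
      (mul_le_mul_of_nonneg_left (min_le_left _ _) (by positivity)).trans (hbwd d hd h)⟩
  · refine ⟨(mul_le_mul_of_nonneg_left (min_le_right _ _) (by positivity)).trans ?_,
      (mul_le_mul_of_nonneg_left (min_le_right _ _) (by positivity)).trans ?_⟩
    · have hslope' : ∀ t, ρ ≤ t → m * ρ ≤ g' t - g' 0 := fun t ht => by
        have := le_of_hasDerivAt_nonneg ht hd2 (fun s _ _ => (hpos s).le)
        linarith [hslope ρ hρ le_rfl]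
      have := le_of_hasDerivAt_nonneg h
        (fun s => ((hd1 s).sub (hlin (g' 0) s)).sub (hlin (m / 2 * ρ) s))
        (fun s hs0 _ => by nlinarith [hslope' s hs0])
      simp only [Pi.sub_apply] at this
      nlinarith [hfwd ρ hρ le_rfl]
    · have := le_of_hasDerivAt_nonneg h hbwd_deriv
        (fun s hs _ => mul_nonneg (hpos s).le (hρ.trans hs))
      linarith [hbwd ρ hρ le_rfl]

/-- Lower bounds for both Bregman divergences of a function whose second derivative has a
`κ`-Lipschitz logarithm. -/
lemma bregman_lower_bounds_of_log_lipschitz {f f' f'' : ℝ → ℝ}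
    (hd1 : ∀ t, HasDerivAt f (f' t) t) (hd2 : ∀ t, HasDerivAt f' (f'' t) t)
    (hpos : ∀ t, 0 < f'' t) {κ : ℝ} (hκ : 0 < κ)
    (hlip : ∀ s t : ℝ, |Real.log (f'' t) - Real.log (f'' s)| ≤ κ * |t - s|) (u a : ℝ) :
    f'' u / (2 * Real.exp 1) * min ((a - u) ^ 2) (|a - u| * κ⁻¹)
        ≤ f a - f u - f' u * (a - u) ∧
      f'' u / (2 * Real.exp 1) * min ((a - u) ^ 2) (κ⁻¹ ^ 2)
        ≤ f u - f a - f' a * (u - a) := by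
  obtain ⟨σ, hσ, hσa⟩ : ∃ σ : ℝ, |σ| = 1 ∧ a - u = σ * |a - u| := by
    rcases le_total 0 (a - u) with h | h
    · exact ⟨1, by simp, by rw [abs_of_nonneg h]; ring⟩
    · exact ⟨-1, by simp, by rw [abs_of_nonpos h]; ring⟩
  have hσ2 : σ * σ = 1 := by rw [← abs_mul_abs_self, hσ, one_mul]
  have hline : ∀ t : ℝ, HasDerivAt (fun t => u + σ * t) σ t := fun t => by
    simpa using ((hasDerivAt_id t).const_mul σ).const_add u
  have key := bregman_lower_bounds_of_nonneg (g := fun t => f (u + σ * t))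
    (g' := fun t => f' (u + σ * t) * σ) (g'' := fun t => f'' (u + σ * t))
    (m := f'' u / Real.exp 1) (ρ := κ⁻¹) (d := |a - u|)
    (fun t => (hd1 _).comp t (hline t))
    (fun t => (((hd2 _).comp t (hline t)).mul_const σ).congr_deriv (by
      rw [mul_assoc, hσ2, mul_one]))
    (fun t => hpos _) (div_nonneg (hpos u).le (Real.exp_pos 1).le) (inv_pos.2 hκ).le
    (abs_nonneg _) (fun t h0 h1 => by
      rw [div_le_iff₀ (Real.exp_pos 1), ← Real.log_le_log_iff (hpos _)
        (mul_pos (hpos _) (Real.exp_pos 1)), Real.log_mul (hpos _).ne' (Real.exp_pos 1).ne',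
        Real.log_exp]
      have h2 := (le_abs_self _).trans (hlip (u + σ * t) u)
      have h3 : |u - (u + σ * t)| = t := by
        rw [sub_add_cancel_left, abs_neg, abs_mul, hσ, one_mul, abs_of_nonneg h0]
      have h4 : κ * t ≤ 1 := by
        calc κ * t ≤ κ * κ⁻¹ := by gcongr
          _ = 1 := mul_inv_cancel₀ hκ.ne'
      rw [h3] at h2
      linarith)
  simp only [mul_zero, add_zero, sq_abs, mul_assoc, ← hσa, add_sub_cancel] at key
  rw [div_div, mul_comm (Real.exp 1) 2] at key
  exact ⟨key.1, key.2.trans_eq (by ring)⟩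

/-- Lemma `lm:GLM`, restricted convexity lower bounds for generalized linear
models with loss `L(β) = Σᵢ ℓᵢ(⟪xᵢ, β⟫)`: if `|ln ℓᵢ''(t) − ln ℓᵢ''(s)| ≤ κ·|t − s|`,
`0 < N(β − β̄) ≤ r`, and the ray from `β̄` through `β` meets `C`, then
`D_L(β, β̄) ≥ γ₁(β̄; κr, C, N)·N(β − β̄)²` and `D_L(β̄, β) ≥ γ₂(β̄; κr, C, N)·N(β − β̄)²`,
where `γ_j(β̄; r, C, N)` is the infimum over `β ∈ C`, `β ≠ β̄`, of
`Σᵢ (ℓᵢ''(⟪xᵢ, β̄⟫)/(2e))·min(⟪xᵢ, β − β̄⟫²/N(β − β̄)², |⟪xᵢ, β − β̄⟫|^{2−j}/(r^j·N(β − β̄)^{2−j}))`. -/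
theorem stmt18
    {E : Type*} [NormedAddCommGroup E] [InnerProductSpace ℝ E] [FiniteDimensional ℝ E]
    (n : ℕ) (x : Fin n → E)
    (ℓ ℓ' ℓ'' : Fin n → ℝ → ℝ)
    (hconv : ∀ i, ConvexOn ℝ Set.univ (ℓ i))
    (hd1 : ∀ i t, HasDerivAt (ℓ i) (ℓ' i t) t)
    (hd2 : ∀ i t, HasDerivAt (ℓ' i) (ℓ'' i t) t)
    (hcont : ∀ i, Continuous (ℓ'' i))
    (hpos : ∀ i t, 0 < ℓ'' i t)
    (κ : ℝ) (hκ : 0 < κ)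
    (hlip : ∀ i, ∀ s t : ℝ, |Real.log (ℓ'' i t) - Real.log (ℓ'' i s)| ≤ κ * |t - s|)
    (N : E → ℝ)
    (hNnonneg : ∀ y, 0 ≤ N y) (hNzero : ∀ y, N y = 0 ↔ y = 0)
    (hNsmul : ∀ (c : ℝ) (y : E), N (c • y) = |c| * N y)
    (hNadd : ∀ y y' : E, N (y + y') ≤ N y + N y')
    (βbar : E) (C : Set E)
    (r : ℝ) (hr : 0 < r)
    (β : E) (hβpos : 0 < N (β - βbar)) (hβr : N (β - βbar) ≤ r)
    (hray : ∃ t : ℝ, 0 < t ∧ βbar + t • (β - βbar) ∈ C) :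
    (sInf ((fun b => ∑ i, (ℓ'' i ⟪x i, βbar⟫ / (2 * Real.exp 1)) *
          min (⟪x i, b - βbar⟫ ^ 2 / N (b - βbar) ^ 2)
            (|⟪x i, b - βbar⟫| / ((κ * r) * N (b - βbar)))) '' {b ∈ C | b ≠ βbar}))
        * N (β - βbar) ^ 2
      ≤ (∑ i, ℓ i ⟪x i, β⟫) - (∑ i, ℓ i ⟪x i, βbar⟫)
          - ⟪∑ i, ℓ' i ⟪x i, βbar⟫ • x i, β - βbar⟫
    ∧
    (sInf ((fun b => ∑ i, (ℓ'' i ⟪x i, βbar⟫ / (2 * Real.exp 1)) *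
          min (⟪x i, b - βbar⟫ ^ 2 / N (b - βbar) ^ 2)
            (1 / (κ * r) ^ 2)) '' {b ∈ C | b ≠ βbar}))
        * N (β - βbar) ^ 2
      ≤ (∑ i, ℓ i ⟪x i, βbar⟫) - (∑ i, ℓ i ⟪x i, β⟫)
          - ⟪∑ i, ℓ' i ⟪x i, β⟫ • x i, βbar - β⟫ := by
  obtain ⟨t, ht, htC⟩ := hray
  have hmem : βbar + t • (β - βbar) ∈ {b ∈ C | b ≠ βbar} := by
    refine ⟨htC, fun h => ?_⟩
    rw [add_eq_left, smul_eq_zero] at h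
    rcases h with h | h
    · exact ht.ne' h
    · exact hβpos.ne' ((hNzero _).2 h)
  have hscalar := fun i => bregman_lower_bounds_of_log_lipschitz (hd1 i) (hd2 i) (hpos i) hκ
    (hlip i) ⟪x i, βbar⟫ ⟪x i, β⟫
  have hw : ∀ i, 0 ≤ ℓ'' i ⟪x i, βbar⟫ / (2 * Real.exp 1) := fun i =>
    div_nonneg (hpos i _).le (by positivity)
  constructor
  · refine (mul_le_mul_of_nonneg_right (csInf_le ?_ (Set.mem_image_of_mem _ hmem))
      (sq_nonneg _)).trans ?_
    · refine ⟨0, ?_⟩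
      rintro _ ⟨b, -, rfl⟩
      refine Finset.sum_nonneg fun i _ => mul_nonneg (hw i) (le_min (by positivity) ?_)
      have := hNnonneg (b - βbar)
      positivity
    · simp only [add_sub_cancel_left, inner_smul_right, hNsmul, abs_of_pos ht, abs_mul,
        sum_inner, real_inner_smul_left, inner_sub_right]
      simp only [Finset.sum_mul, ← Finset.sum_sub_distrib, ← mul_sub]
      refine Finset.sum_le_sum fun i _ => le_trans ?_ (hscalar i).1
      rw [mul_assoc]
      refine mul_le_mul_of_nonneg_left ?_ (hw i)
      set d := ⟪x i, β⟫ - ⟪x i, βbar⟫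
      set M := N (β - βbar)
      rw [min_mul_of_nonneg _ _ (sq_nonneg M)]
      refine min_le_min (le_of_eq (by field_simp)) ?_
      calc t * |d| / (κ * r * (t * M)) * M ^ 2 = |d| * κ⁻¹ * (M / r) := by field_simp
        _ ≤ |d| * κ⁻¹ * 1 := by
          have : M / r ≤ 1 := (div_le_one hr).2 hβr
          gcongr
        _ = |d| * κ⁻¹ := mul_one _
  · refine (mul_le_mul_of_nonneg_right (csInf_le ?_ (Set.mem_image_of_mem _ hmem))
      (sq_nonneg _)).trans ?_
    · refine ⟨0, ?_⟩
      rintro _ ⟨b, -, rfl⟩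
      exact Finset.sum_nonneg fun i _ => mul_nonneg (hw i) (by positivity)
    · simp only [add_sub_cancel_left, inner_smul_right, hNsmul, abs_of_pos ht,
        sum_inner, real_inner_smul_left, inner_sub_right]
      simp only [Finset.sum_mul, ← Finset.sum_sub_distrib, ← mul_sub]
      refine Finset.sum_le_sum fun i _ => le_trans ?_ (hscalar i).2
      rw [mul_assoc]
      refine mul_le_mul_of_nonneg_left ?_ (hw i)
      set d := ⟪x i, β⟫ - ⟪x i, βbar⟫
      set M := N (β - βbar)
      rw [min_mul_of_nonneg _ _ (sq_nonneg M)]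
      refine min_le_min (le_of_eq (by field_simp)) ?_
      calc 1 / (κ * r) ^ 2 * M ^ 2 = κ⁻¹ ^ 2 * (M / r) ^ 2 := by field_simp
        _ ≤ κ⁻¹ ^ 2 * 1 ^ 2 := by
          have : M / r ≤ 1 := (div_le_one hr).2 hβr
          gcongr
        _ = κ⁻¹ ^ 2 := by ring
end

section
/- Oracle inequality for generalized linear models: suppose (noise level) there is η < 1 with |⟪∇L(β*), β⟫| ≤ η·R(β) for all β ∈ E; (penalty level) λ > 0 satisfies ⟪∇L(β*) + u, β̄ − β⟫ ≤ λ·N(β − β̄) for every β ∈ E and every subgradient u of R at β; (restricted convexity) γ > 0 satisfies Σ_{i=1}^n (ℓ_i''(⟪x_i, β̄⟫)/(2e)) · min( ⟪x_i, β − β̄⟫² / N(β − β̄)², 1 ) ≥ γ for every β ∈ C_{β̄,β*} with β ≠ β̄; and every β ∈ C_{β̄,β*} satisfies N(β − β̄) ≤ γ/(κ²·λ) + λ/(4·γ). Then D_L(β̂, β*) ≤ D_L(β̄, β*) + λ²/(4·γ). -/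
open RealInnerProductSpace

/-- The second-order Bregman remainder of a scalar function, bounded below by truncating the
segment at a fraction `m` on which the second derivative shrinks by a factor at most `e`. -/
theorem bregman_lower_bound_of_le {f f' f'' : ℝ → ℝ}
    (hd1 : ∀ t, HasDerivAt f (f' t) t) (hd2 : ∀ t, HasDerivAt f' (f'' t) t)
    (hpos : ∀ t, 0 < f'' t) {κ : ℝ}
    (hlip : ∀ s t : ℝ, |Real.log (f'' t) - Real.log (f'' s)| ≤ κ * |t - s|)
    (a t m : ℝ) (hm0 : 0 ≤ m) (hm1 : m ≤ 1) (hκ : 0 ≤ κ) (hm : κ * (m * |t|) ≤ 1) :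
    f'' a / (2 * Real.exp 1) * (m * t) ^ 2 ≤ f a - f (a + t) + f' (a + t) * t := by
  have hline : ∀ s : ℝ, HasDerivAt (fun s : ℝ => a + s * t) t s := fun s => by
    simpa using ((hasDerivAt_id s).mul_const t).const_add a
  have hg : ∀ s : ℝ, HasDerivAt (fun s : ℝ => f a - f (a + s * t) + f' (a + s * t) * (s * t))
      (s * t ^ 2 * f'' (a + s * t)) s := fun s => by
    have h1 := (hd1 (a + s * t)).comp s (hline s)
    have h2 := (hd2 (a + s * t)).comp s (hline s)
    have h3 : HasDerivAt (fun s : ℝ => s * t) t s := by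
      simpa using (hasDerivAt_id s).mul_const t
    refine ((h1.const_sub (f a)).add (h2.mul h3)).congr_deriv ?_
    simp only [Function.comp]
    ring
  have hmono : MonotoneOn (fun s : ℝ => f a - f (a + s * t) + f' (a + s * t) * (s * t))
      (Set.Icc 0 1) := by
    refine monotoneOn_of_hasDerivWithinAt_nonneg (convex_Icc 0 1)
      (fun s _ => (hg s).continuousAt.continuousWithinAt)
      (fun s _ => (hg s).hasDerivWithinAt) ?_
    intro s hs
    rw [interior_Icc] at hs
    have := hpos (a + s * t)
    have := hs.1
    positivity
  have hh : ∀ s : ℝ, HasDerivAt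
      (fun s : ℝ => f a - f (a + s * t) + f' (a + s * t) * (s * t)
        - f'' a / (2 * Real.exp 1) * (s * t) ^ 2)
      (s * t ^ 2 * f'' (a + s * t) - s * t ^ 2 * (f'' a / Real.exp 1)) s := fun s => by
    have h3 : HasDerivAt (fun s : ℝ => s * t) t s := by
      simpa using (hasDerivAt_id s).mul_const t
    refine ((hg s).sub ((h3.pow 2).const_mul (f'' a / (2 * Real.exp 1)))).congr_deriv ?_
    have := Real.exp_pos 1
    field_simp
    simp
    ring
  have hmono' : MonotoneOn (fun s : ℝ => f a - f (a + s * t) + f' (a + s * t) * (s * t)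
        - f'' a / (2 * Real.exp 1) * (s * t) ^ 2) (Set.Icc 0 m) := by
    refine monotoneOn_of_hasDerivWithinAt_nonneg (convex_Icc 0 m)
      (fun s _ => (hh s).continuousAt.continuousWithinAt)
      (fun s _ => (hh s).hasDerivWithinAt) ?_
    intro s hs
    rw [interior_Icc] at hs
    have hle : κ * |a - (a + s * t)| ≤ 1 := by
      refine le_trans ?_ hm
      rw [show a - (a + s * t) = -(s * t) by ring, abs_neg, abs_mul, abs_of_pos hs.1]
      have := hs.2.le
      gcongr
    have hlog : Real.log (f'' a) - 1 ≤ Real.log (f'' (a + s * t)) := by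
      have := (le_abs_self _).trans ((hlip (a + s * t) a).trans hle)
      linarith
    have hlow : f'' a / Real.exp 1 ≤ f'' (a + s * t) := by
      have := Real.exp_le_exp.mpr hlog
      rwa [Real.exp_sub, Real.exp_log (hpos _), Real.exp_log (hpos _)] at this
    have hs0 : 0 ≤ s * t ^ 2 := mul_nonneg hs.1.le (sq_nonneg t)
    exact sub_nonneg.mpr (mul_le_mul_of_nonneg_left hlow hs0)
  have h1 := hmono ⟨hm0, hm1⟩ (Set.right_mem_Icc.mpr zero_le_one) hm1
  have h2 := hmono' (Set.left_mem_Icc.mpr hm0) (Set.right_mem_Icc.mpr hm0) hm0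
  simp only [zero_mul, add_zero, one_mul, mul_zero, sub_self] at h1 h2
  linarith

/-- Lower bound for the Bregman divergence of a scalar function whose second derivative is
log-Lipschitz: quadratic at scales below `1 / κ`, constant beyond. -/
theorem bregman_lower_bound {f f' f'' : ℝ → ℝ}
    (hd1 : ∀ t, HasDerivAt f (f' t) t) (hd2 : ∀ t, HasDerivAt f' (f'' t) t)
    (hpos : ∀ t, 0 < f'' t) {κ : ℝ} (hκ : 0 < κ)
    (hlip : ∀ s t : ℝ, |Real.log (f'' t) - Real.log (f'' s)| ≤ κ * |t - s|) (a t : ℝ) :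
    f'' a / (2 * Real.exp 1) * min (t ^ 2) (1 / κ ^ 2) ≤ f a - f (a + t) + f' (a + t) * t := by
  have hc : 0 ≤ f'' a / (2 * Real.exp 1) := by
    have := hpos a
    positivity
  by_cases ht : κ * |t| ≤ 1
  · refine le_trans (mul_le_mul_of_nonneg_left (min_le_left _ _) hc) ?_
    simpa using bregman_lower_bound_of_le hd1 hd2 hpos hlip a t 1 zero_le_one le_rfl hκ.le
      (by simpa using ht)
  · push Not at ht
    have ht0 : 0 < |t| := by
      by_contra h
      rw [le_antisymm (not_lt.mp h) (abs_nonneg t)] at ht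
      linarith
    refine le_trans (mul_le_mul_of_nonneg_left (min_le_right _ _) hc) ?_
    have h := bregman_lower_bound_of_le hd1 hd2 hpos hlip a t (1 / (κ * |t|)) (by positivity)
      ((div_le_one (by positivity)).mpr ht.le) hκ.le (by field_simp; exact le_rfl)
    have hsq : (1 / (κ * |t|) * t) ^ 2 = 1 / κ ^ 2 := by
      rw [mul_pow, div_pow, mul_pow, sq_abs]
      have : t ≠ 0 := abs_pos.mp ht0
      field_simp
    rwa [hsq] at h

/-- First-order optimality: if `G + R` is minimal at `b` with `R` convex, then minus the
directional derivative of `G` is a subgradient of `R`. -/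
theorem sub_le_of_isMin_add {E : Type*} [AddCommGroup E] [Module ℝ E] {G R : E → ℝ}
    (hR : ConvexOn ℝ Set.univ R) {b y : E} (hmin : ∀ z, G b + R b ≤ G z + R z) {D : ℝ}
    (hD : HasDerivAt (fun s : ℝ => G (b + s • (y - b))) D 0) : R b - D ≤ R y := by
  have hlim := (hasDerivAt_iff_tendsto_slope.mp hD).mono_left
    (nhdsWithin_mono 0 (fun s (hs : s ∈ Set.Ioi (0 : ℝ)) => ne_of_gt hs))
  have hge : R b - R y ≤ D := by
    refine ge_of_tendsto hlim ?_
    filter_upwards [Ioo_mem_nhdsGT (zero_lt_one' ℝ)] with s hs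
    have hc := hR.2 (Set.mem_univ b) (Set.mem_univ y) (sub_nonneg.mpr hs.2.le) hs.1.le
      (sub_add_cancel 1 s)
    rw [show (1 - s) • b + s • y = b + s • (y - b) by module] at hc
    have h := hmin (b + s • (y - b))
    simp only [smul_eq_mul] at hc
    rw [slope_def_field, le_div_iff₀ (by simpa using hs.1)]
    simp only [zero_smul, add_zero, sub_zero]
    linarith
  linarith

/-- Theorem `thm:GLM`, oracle inequality for generalized linear models with
loss `L(β) = Σᵢ ℓᵢ(⟪xᵢ, β⟫)` and penalized estimator `β̂` minimizing `L + R` over `E`: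
under the noise-level condition (`|⟪∇L(β*), β⟫| ≤ η·R(β)` with `η < 1`), the penalty-level
condition (`⟪∇L(β*) + u, β̄ − β⟫ ≤ λ·N(β − β̄)` for every subgradient `u` of `R` at `β`),
restricted convexity with constant `γ > 0` over `C_{β̄,β*}`, and the diameter bound
`N(β − β̄) ≤ γ/(κ²λ) + λ/(4γ)` on `C_{β̄,β*}`, one has
`D_L(β̂, β*) ≤ D_L(β̄, β*) + λ²/(4γ)`. -/
theorem stmt19
    {E : Type*} [NormedAddCommGroup E] [InnerProductSpace ℝ E] [FiniteDimensional ℝ E]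
    (n : ℕ) (x : Fin n → E)
    (ℓ ℓ' ℓ'' : Fin n → ℝ → ℝ)
    (hconv : ∀ i, ConvexOn ℝ Set.univ (ℓ i))
    (hd1 : ∀ i t, HasDerivAt (ℓ i) (ℓ' i t) t)
    (hd2 : ∀ i t, HasDerivAt (ℓ' i) (ℓ'' i t) t)
    (hcont : ∀ i, Continuous (ℓ'' i))
    (hpos : ∀ i t, 0 < ℓ'' i t)
    (κ : ℝ) (hκ : 0 < κ)
    (hlip : ∀ i, ∀ s t : ℝ, |Real.log (ℓ'' i t) - Real.log (ℓ'' i s)| ≤ κ * |t - s|)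
    (N : E → ℝ)
    (hNnonneg : ∀ y, 0 ≤ N y) (hNzero : ∀ y, N y = 0 ↔ y = 0)
    (hNsmul : ∀ (c : ℝ) (y : E), N (c • y) = |c| * N y)
    (hNadd : ∀ y y' : E, N (y + y') ≤ N y + N y')
    (R : E → ℝ) (hRconv : ConvexOn ℝ Set.univ R)
    (βhat : E)
    (hmin : ∀ β : E, (∑ i, ℓ i ⟪x i, βhat⟫) + R βhat ≤ (∑ i, ℓ i ⟪x i, β⟫) + R β)
    (βbar βstar : E)
    (η : ℝ) (hη : η < 1)
    (hnoise : ∀ β : E, |⟪∑ i, ℓ' i ⟪x i, βstar⟫ • x i, β⟫| ≤ η * R β)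
    (lam : ℝ) (hlam : 0 < lam)
    (hpen : ∀ β u : E, (∀ y : E, R β + ⟪u, y - β⟫ ≤ R y) →
      ⟪(∑ i, ℓ' i ⟪x i, βstar⟫ • x i) + u, βbar - β⟫ ≤ lam * N (β - βbar))
    (Cset : Set E)
    (hCset : Cset = {β : E | ∃ u : E, (∀ y : E, R β + ⟪u, y - β⟫ ≤ R y) ∧
      0 < ⟪u + ∑ i, ℓ' i ⟪x i, βstar⟫ • x i, βbar - β⟫})
    (γ : ℝ) (hγ : 0 < γ)
    (hRSC : ∀ β ∈ Cset, β ≠ βbar →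
      γ ≤ ∑ i, (ℓ'' i ⟪x i, βbar⟫ / (2 * Real.exp 1)) *
        min (⟪x i, β - βbar⟫ ^ 2 / N (β - βbar) ^ 2) 1)
    (hdiam : ∀ β ∈ Cset, N (β - βbar) ≤ γ / (κ ^ 2 * lam) + lam / (4 * γ)) :
    (∑ i, ℓ i ⟪x i, βhat⟫) - (∑ i, ℓ i ⟪x i, βstar⟫)
        - ⟪∑ i, ℓ' i ⟪x i, βstar⟫ • x i, βhat - βstar⟫
      ≤ (∑ i, ℓ i ⟪x i, βbar⟫) - (∑ i, ℓ i ⟪x i, βstar⟫)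
          - ⟪∑ i, ℓ' i ⟪x i, βstar⟫ • x i, βbar - βstar⟫
        + lam ^ 2 / (4 * γ) := by
  have hsub : ∀ y : E, R βhat + ⟪-∑ i, ℓ' i ⟪x i, βhat⟫ • x i, y - βhat⟫ ≤ R y := by
    intro y
    have hder : HasDerivAt (fun s : ℝ => ∑ i, ℓ i ⟪x i, βhat + s • (y - βhat)⟫)
        (∑ i, ℓ' i ⟪x i, βhat⟫ * ⟪x i, y - βhat⟫) 0 := by
      refine HasDerivAt.fun_sum fun i _ => ?_
      have hl : HasDerivAt (fun s : ℝ => ⟪x i, βhat + s • (y - βhat)⟫) ⟪x i, y - βhat⟫ 0 := by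
        simp only [inner_add_right, inner_smul_right]
        simpa using ((hasDerivAt_id (0 : ℝ)).mul_const ⟪x i, y - βhat⟫).const_add ⟪x i, βhat⟫
      exact HasDerivAt.comp_of_eq 0 (hd1 i _) hl (by simp)
    have h := sub_le_of_isMin_add (G := fun β => ∑ i, ℓ i ⟪x i, β⟫) hRconv hmin hder
    simpa [inner_neg_left, sum_inner, real_inner_smul_left, sub_eq_add_neg] using h
  have hkey : (∑ i, ℓ i ⟪x i, βhat⟫) - (∑ i, ℓ i ⟪x i, βbar⟫)
        - ⟪∑ i, ℓ' i ⟪x i, βstar⟫ • x i, βhat - βbar⟫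
      = ⟪-(∑ i, ℓ' i ⟪x i, βhat⟫ • x i) + ∑ i, ℓ' i ⟪x i, βstar⟫ • x i, βbar - βhat⟫
        - ∑ i, (ℓ i ⟪x i, βbar⟫ - ℓ i (⟪x i, βbar⟫ + ⟪x i, βhat - βbar⟫)
          + ℓ' i (⟪x i, βbar⟫ + ⟪x i, βhat - βbar⟫) * ⟪x i, βhat - βbar⟫) := by
    have hs : ∀ i, ⟪x i, βbar⟫ + ⟪x i, βhat - βbar⟫ = ⟪x i, βhat⟫ := fun i => by
      rw [inner_sub_right]; ring
    simp only [hs, Finset.sum_add_distrib, Finset.sum_sub_distrib]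
    rw [← neg_sub βhat βbar, inner_neg_right, inner_add_left, inner_neg_left,
      sum_inner (f := fun i => ℓ' i ⟪x i, βhat⟫ • x i)]
    simp only [real_inner_smul_left]
    ring
  have hD : ∀ i, ℓ'' i ⟪x i, βbar⟫ / (2 * Real.exp 1)
        * min (⟪x i, βhat - βbar⟫ ^ 2) (1 / κ ^ 2)
      ≤ ℓ i ⟪x i, βbar⟫ - ℓ i (⟪x i, βbar⟫ + ⟪x i, βhat - βbar⟫)
          + ℓ' i (⟪x i, βbar⟫ + ⟪x i, βhat - βbar⟫) * ⟪x i, βhat - βbar⟫ := fun i =>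
    bregman_lower_bound (hd1 i) (hd2 i) (hpos i) hκ (hlip i) _ _
  have hw : ∀ i, 0 ≤ ℓ'' i ⟪x i, βbar⟫ / (2 * Real.exp 1) := fun i => by
    have := hpos i ⟪x i, βbar⟫
    positivity
  have hDsum := Finset.sum_le_sum fun i (_ : i ∈ Finset.univ) => hD i
  have hgoal : (∑ i, ℓ i ⟪x i, βhat⟫) - (∑ i, ℓ i ⟪x i, βbar⟫)
        - ⟪∑ i, ℓ' i ⟪x i, βstar⟫ • x i, βhat - βbar⟫ ≤ lam ^ 2 / (4 * γ) := by
    rw [hkey]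
    have hq : 0 ≤ lam ^ 2 / (4 * γ) := by positivity
    by_cases hC : 0 < ⟪-(∑ i, ℓ' i ⟪x i, βhat⟫ • x i)
        + ∑ i, ℓ' i ⟪x i, βstar⟫ • x i, βbar - βhat⟫
    swap
    · have : 0 ≤ ∑ i, ℓ'' i ⟪x i, βbar⟫ / (2 * Real.exp 1)
          * min (⟪x i, βhat - βbar⟫ ^ 2) (1 / κ ^ 2) :=
        Finset.sum_nonneg fun i _ => mul_nonneg (hw i) (le_min (sq_nonneg _) (by positivity))
      linarith
    have hmem : βhat ∈ Cset := by
      rw [hCset]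
      exact ⟨_, hsub, hC⟩
    have hne : βhat ≠ βbar := by
      rintro rfl
      simp at hC
    have hN : 0 < N (βhat - βbar) := (hNnonneg _).lt_of_ne' fun h =>
      hne (sub_eq_zero.mp ((hNzero _).mp h))
    have hpen' := hpen βhat _ hsub
    rw [add_comm] at hpen'
    have hrsc := hRSC βhat hmem hne
    have hdm := hdiam βhat hmem
    generalize N (βhat - βbar) = M at *
    have hscale : ∀ r : ℝ, 0 ≤ r → r ≤ M ^ 2 → r ≤ 1 / κ ^ 2 →
        r * γ ≤ ∑ i, ℓ'' i ⟪x i, βbar⟫ / (2 * Real.exp 1)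
          * min (⟪x i, βhat - βbar⟫ ^ 2) (1 / κ ^ 2) := by
      intro r hr hrM hrκ
      refine (mul_le_mul_of_nonneg_left hrsc hr).trans ?_
      rw [Finset.mul_sum]
      refine Finset.sum_le_sum fun i _ => ?_
      rw [mul_left_comm]
      refine mul_le_mul_of_nonneg_left ?_ (hw i)
      rw [mul_min_of_nonneg _ _ hr, mul_one]
      refine min_le_min ?_ hrκ
      rw [mul_div_left_comm]
      exact mul_le_of_le_one_right (sq_nonneg _) ((div_le_one (by positivity)).mpr hrM)
    suffices lam * M - lam ^ 2 / (4 * γ) ≤ ∑ i, ℓ'' i ⟪x i, βbar⟫ / (2 * Real.exp 1)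
          * min (⟪x i, βhat - βbar⟫ ^ 2) (1 / κ ^ 2) by linarith
    rcases le_total (M ^ 2) (1 / κ ^ 2) with h | h
    · refine le_trans ?_ (hscale (M ^ 2) (sq_nonneg M) le_rfl h)
      have hsq : M ^ 2 * γ - (lam * M - lam ^ 2 / (4 * γ)) = (2 * γ * M - lam) ^ 2 / (4 * γ) := by
        field_simp
        ring
      have : 0 ≤ (2 * γ * M - lam) ^ 2 / (4 * γ) := by positivity
      linarith
    · refine le_trans ?_ (hscale (1 / κ ^ 2) (by positivity) h le_rfl)
      have h2 := mul_le_mul_of_nonneg_left hdm hlam.le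
      have h3 : lam * (γ / (κ ^ 2 * lam) + lam / (4 * γ))
          = 1 / κ ^ 2 * γ + lam ^ 2 / (4 * γ) := by
        field_simp
      linarith
  have hsplit : ⟪∑ i, ℓ' i ⟪x i, βstar⟫ • x i, βhat - βbar⟫
      = ⟪∑ i, ℓ' i ⟪x i, βstar⟫ • x i, βhat - βstar⟫
        - ⟪∑ i, ℓ' i ⟪x i, βstar⟫ • x i, βbar - βstar⟫ := by
    rw [← inner_sub_right, sub_sub_sub_cancel_right]
  linarith
end
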